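/- arXiv:1805.02554 — 6 statements merged into one kernel-verified Lean document; each statement's English description precedes it below -/
import Mathlib

section
/- Let J = ℕ if n > 3 and J = {j ∈ ℕ : j ≥ 1} if n = 3, and let P := {m j : j ∈ J} ∪ {(m j)̄ : j ∈ J} ⊆ F. Then the sublattice of F generated by P is completely freely generated by the ordered set (P, ≤) (order induced from F): for every lattice K and every monotone map f : P → K, there exists a lattice homomorphism from the sublattice of F generated by P to K whose restriction to P equals f. -/
open Cardinal

universe u

/-- A lattice `F` is freely generated by the family `x : ι → F` if the sublattice generated by
the range of `x` is all of `F` and every map from the generators into a lattice extends to a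
lattice homomorphism. -/
def IsFreelyGenerated {F : Type*} [Lattice F] {ι : Type*} (x : ι → F) : Prop :=
  latticeClosure (Set.range x) = Set.univ ∧
    ∀ (K : Type*) [Lattice K] (f : ι → K), ∃ φ : LatticeHom F K, ∀ i, φ (x i) = f i

/-- The image of `t` under a dual automorphism `δ : F ≃o Fᵒᵈ`, viewed back in `F`. -/
def dBar {F : Type*} [Lattice F] (δ : F ≃o Fᵒᵈ) (t : F) : F := OrderDual.ofDual (δ t)

/-- A subset `S` of `F` is selfdually positioned (w.r.t. the dual automorphism `δ`)
if `δ '' S = S`. -/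
def SelfduallyPositioned {F : Type*} [Lattice F] (δ : F ≃o Fᵒᵈ) (S : Set F) : Prop :=
  dBar δ '' S = S

/-- The elements `p i j` of `F`: `p i 0 = x i` and `p i (j+1)` is `x i` joined with the
supremum of `p i₁ j ⊓ p i₂ j` over all pairs `i₁ ≠ i₂` avoiding `i`. -/
def freeP {n : ℕ} {F : Type*} [Lattice F] (x : Fin n → F) : ℕ → Fin n → F
  | 0, i => x i
  | j + 1, i =>
    (Finset.univ.filter fun q : Fin n × Fin n => q.1 ≠ q.2 ∧ q.1 ≠ i ∧ q.2 ≠ i).fold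
      (· ⊔ ·) (x i) (fun q => freeP x j q.1 ⊓ freeP x j q.2)

/-- The element `m j`: the supremum of `p i₁ j ⊓ p i₂ j` over all pairs `i₁ ≠ i₂`. -/
def freeM {n : ℕ} {F : Type*} [Lattice F] (hn : 3 ≤ n) (x : Fin n → F) (j : ℕ) : F :=
  (Finset.univ.filter fun q : Fin n × Fin n => q.1 ≠ q.2).sup'
    ⟨(⟨0, by omega⟩, ⟨1, by omega⟩), by simp [Fin.ext_iff]⟩
    (fun q => freeP x j q.1 ⊓ freeP x j q.2)

/-- The sublattice of `F` generated by a subset `S`. -/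
def genSub {F : Type*} [Lattice F] (S : Set F) : Sublattice F :=
  Sublattice.ofIsSublattice (latticeClosure S) isSublattice_latticeClosure

/-- The set `P = {m j : j ∈ J} ∪ {(m j)̄ : j ∈ J}`, where `J = ℕ` if `n > 3` and
`J = {j : 1 ≤ j}` if `n = 3`. -/
def pSet {n : ℕ} {F : Type*} [Lattice F] (hn : 3 ≤ n) (x : Fin n → F)
    (δ : F ≃o Fᵒᵈ) : Set F :=
  {u | ∃ j : ℕ, (n = 3 → 1 ≤ j) ∧ (u = freeM hn x j ∨ u = dBar δ (freeM hn x j))}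

namespace PFree

section basic
variable {n : ℕ} {L : Type*} [Lattice L] (y : Fin n → L)

theorem freeP_succ_le_iff (j : ℕ) (i : Fin n) (t : L) :
    freeP y (j + 1) i ≤ t ↔ y i ≤ t ∧
      ∀ a b, a ≠ b → a ≠ i → b ≠ i → freeP y j a ⊓ freeP y j b ≤ t := by
  have h := Finset.fold_op_rel_iff_and (op := fun a b : L => a ⊔ b) (r := fun a b : L => b ≤ a)
    (fun {x y z} => sup_le_iff)
    (s := Finset.univ.filter fun q : Fin n × Fin n => q.1 ≠ q.2 ∧ q.1 ≠ i ∧ q.2 ≠ i)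
    (f := fun q => freeP y j q.1 ⊓ freeP y j q.2) (b := y i) (c := t)
  rw [freeP]
  refine h.trans ?_
  simp only [Finset.mem_filter, Finset.mem_univ, true_and, Prod.forall]
  refine and_congr Iff.rfl ⟨fun h a b h1 h2 h3 => h a b ⟨h1, h2, h3⟩,
    fun h a b h1 => h a b h1.1 h1.2.1 h1.2.2⟩

theorem le_freeP (j : ℕ) (i : Fin n) : y i ≤ freeP y j i := by
  cases j with
  | zero => exact le_rfl
  | succ j => exact ((freeP_succ_le_iff y j i _).1 le_rfl).1

variable (hn : 3 ≤ n)

theorem freeM_le_iff (j : ℕ) (t : L) :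
    freeM hn y j ≤ t ↔ ∀ a b, a ≠ b → freeP y j a ⊓ freeP y j b ≤ t := by
  simp [freeM, Finset.sup'_le_iff]

theorem le_freeM (j : ℕ) {a b : Fin n} (h : a ≠ b) :
    freeP y j a ⊓ freeP y j b ≤ freeM hn y j :=
  (freeM_le_iff y hn j _).1 le_rfl a b h

theorem freeP_mono_succ (j : ℕ) (i : Fin n) : freeP y j i ≤ freeP y (j + 1) i := by
  induction j generalizing i with
  | zero => exact le_freeP y 1 i
  | succ j ih =>
    rw [freeP_succ_le_iff]
    refine ⟨le_freeP _ _ _, fun a b h1 h2 h3 => ?_⟩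
    exact (inf_le_inf (ih a) (ih b)).trans
      (((freeP_succ_le_iff y (j+1) i _).1 le_rfl).2 a b h1 h2 h3)

theorem freeM_mono : Monotone (freeM hn y) := by
  refine monotone_nat_of_le_succ fun j => ?_
  rw [freeM_le_iff]
  intro a b h
  exact (inf_le_inf (freeP_mono_succ y j a) (freeP_mono_succ y j b)).trans (le_freeM y hn _ h)

theorem freeP_succ (j : ℕ) (i : Fin n) : freeP y (j + 1) i = y i ⊔ freeM hn y j := by
  apply le_antisymm
  · rw [freeP_succ_le_iff]
    exact ⟨le_sup_left, fun a b h1 _ _ => (le_freeM y hn j h1).trans le_sup_right⟩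
  · refine sup_le (le_freeP _ _ _) ?_
    rw [freeM_le_iff]
    intro a b h
    by_cases ha : a = i
    · subst ha
      exact inf_le_left.trans (freeP_mono_succ y j a)
    by_cases hb : b = i
    · subst hb
      exact inf_le_right.trans (freeP_mono_succ y j b)
    exact ((freeP_succ_le_iff y j i _).1 le_rfl).2 a b h ha hb

theorem map_freeM_of {K : Type*} [Lattice K] (φ : LatticeHom L K) (j : ℕ)
    (h : ∀ i, φ (freeP y j i) = freeP (fun i => φ (y i)) j i) :
    φ (freeM hn y j) = freeM hn (fun i => φ (y i)) j := by
  unfold freeM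
  refine (map_finset_sup' φ _ _).trans ?_
  refine Finset.sup'_congr _ rfl fun q _ => ?_
  simp [h]

theorem map_freeP {K : Type*} [Lattice K] (φ : LatticeHom L K) (hn : 3 ≤ n) (j : ℕ) (i : Fin n) :
    φ (freeP y j i) = freeP (fun i => φ (y i)) j i := by
  induction j generalizing i with
  | zero => rfl
  | succ j ih => rw [freeP_succ _ hn, freeP_succ _ hn, map_sup, map_freeM_of y hn φ j ih]

theorem map_freeM {K : Type*} [Lattice K] (φ : LatticeHom L K) (j : ℕ) :
    φ (freeM hn y j) = freeM hn (fun i => φ (y i)) j :=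
  map_freeM_of y hn φ j (map_freeP y φ hn j)

theorem disj_eval [OrderBot L] (h : ∀ a b, a ≠ b → y a ⊓ y b = ⊥) (j : ℕ) :
    (∀ i, freeP y j i = y i) ∧ freeM hn y j = ⊥ := by
  have key : ∀ j, (∀ i, freeP y j i = y i) → freeM hn y j = ⊥ := by
    intro j hj
    rw [eq_bot_iff, freeM_le_iff]
    intro a b hab
    rw [hj, hj, h a b hab]
  have : ∀ i, freeP y j i = y i := by
    induction j with
    | zero => exact fun i => rfl
    | succ j ih => intro i; rw [freeP_succ _ hn, key j ih, sup_bot_eq]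
  exact ⟨this, key j this⟩

end basic

/-! ### The lattice `M_n` -/

inductive MN (n : ℕ) : Type
  | bot : MN n
  | top : MN n
  | atom (i : Fin n) : MN n

namespace MN
variable {n : ℕ}

def le : MN n → MN n → Prop
  | bot, _ => True
  | _, top => True
  | atom i, atom j => i = j
  | top, bot => False
  | top, atom _ => False
  | atom _, bot => False

def sup : MN n → MN n → MN n
  | bot, b => b
  | top, _ => top
  | atom i, bot => atom i
  | atom _, top => top
  | atom i, atom j => if i = j then atom i else top

def inf : MN n → MN n → MN n
  | top, b => b
  | bot, _ => bot
  | atom i, top => atom i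
  | atom _, bot => bot
  | atom i, atom j => if i = j then atom i else bot

instance : Lattice (MN n) where
  le := le
  sup := sup
  inf := inf
  le_refl a := by cases a <;> simp [le]
  le_trans a b c := by cases a <;> cases b <;> cases c <;> simp [le] <;> grind
  le_antisymm a b := by cases a <;> cases b <;> simp [le] <;> grind
  le_sup_left a b := by cases a <;> cases b <;> simp [le, sup] <;> split_ifs <;> simp_all [le]
  le_sup_right a b := by cases a <;> cases b <;> simp [le, sup] <;> split_ifs <;> simp_all [le]
  sup_le a b c := by
    cases a <;> cases b <;> cases c <;> simp [le, sup] <;> split_ifs <;> simp_all [le] <;> grind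
  inf_le_left a b := by cases a <;> cases b <;> simp [le, inf] <;> split_ifs <;> simp_all [le]
  inf_le_right a b := by cases a <;> cases b <;> simp [le, inf] <;> split_ifs <;> simp_all [le]
  le_inf a b c := by
    cases a <;> cases b <;> cases c <;> simp [le, inf] <;> split_ifs <;> simp_all [le]

instance : BoundedOrder (MN n) where
  top := top
  bot := bot
  le_top a := by cases a <;> trivial
  bot_le a := by cases a <;> trivial

instance : Countable (MN n) := by
  let g : MN n → Option (Option (Fin n))
    | bot => none
    | top => some none
    | atom i => some (some i)
  refine Function.Injective.countable (f := g) ?_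
  intro a b
  cases a <;> cases b <;> simp [g]

theorem atom_inf {i j : Fin n} (h : i ≠ j) : atom i ⊓ atom j = (⊥ : MN n) := by
  change inf _ _ = bot
  simp [inf, h]

theorem atom_sup {i j : Fin n} (h : i ≠ j) : atom i ⊔ atom j = (⊤ : MN n) := by
  change sup _ _ = top
  simp [sup, h]

theorem not_top_le (i : Fin n) : ¬ (⊤ : MN n) ≤ atom i := fun h => h

end MN

/-! ### Terms -/

inductive Tm (α : Type*)
  | var (a : α) : Tm α
  | sup (s t : Tm α) : Tm α
  | inf (s t : Tm α) : Tm α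

namespace Tm
variable {α : Type*}

def eval {L : Type*} [Lattice L] (v : α → L) : Tm α → L
  | var a => v a
  | sup s t => eval v s ⊔ eval v t
  | inf s t => eval v s ⊓ eval v t

theorem exists_eval {L : Type*} [Lattice L] (v : α → L) {u : L}
    (hu : u ∈ latticeClosure (Set.range v)) : ∃ t : Tm α, eval v t = u := by
  have hs : IsSublattice (Set.range (eval v)) := by
    constructor
    · rintro _ ⟨s, rfl⟩ _ ⟨t, rfl⟩
      exact ⟨sup s t, rfl⟩
    · rintro _ ⟨s, rfl⟩ _ ⟨t, rfl⟩
      exact ⟨inf s t, rfl⟩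
  have : latticeClosure (Set.range v) ⊆ Set.range (eval v) := by
    refine latticeClosure_min ?_ hs
    rintro _ ⟨a, rfl⟩
    exact ⟨var a, rfl⟩
  exact this hu

def code {n : ℕ} : Tm (Fin n) → ℕ
  | var a => Nat.pair 0 a
  | sup s t => Nat.pair 1 (Nat.pair (code s) (code t))
  | inf s t => Nat.pair 2 (Nat.pair (code s) (code t))

theorem code_injective {n : ℕ} : Function.Injective (code (n := n)) := by
  intro s
  induction s with
  | var a => intro t; cases t <;> simp [code, Nat.pair_eq_pair, Fin.ext_iff]
  | sup a b iha ihb =>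
    intro t
    cases t <;> simp only [code, Nat.pair_eq_pair] <;> try simp
    exact fun h1 h2 => ⟨iha h1, ihb h2⟩
  | inf a b iha ihb =>
    intro t
    cases t <;> simp only [code, Nat.pair_eq_pair] <;> try simp
    exact fun h1 h2 => ⟨iha h1, ihb h2⟩

instance {n : ℕ} : Countable (Tm (Fin n)) := code_injective.countable

end Tm

/-! ### Consequences of freeness -/

section free
universe u1 u2
variable {n : ℕ} {F : Type u1} [Lattice F] {x : Fin n → F}

theorem countable_of_free (hx : IsFreelyGenerated.{u1, 0, u2} x) : Countable F := by
  have : Function.Surjective (Tm.eval x) := fun u =>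
    Tm.exists_eval x (by rw [hx.1]; trivial)
  exact this.countable

theorem hom_ext (hx : IsFreelyGenerated.{u1, 0, u2} x) {K : Type*} [Lattice K]
    {φ ψ : LatticeHom F K} (h : ∀ i, φ (x i) = ψ (x i)) (u : F) : φ u = ψ u := by
  obtain ⟨t, rfl⟩ := Tm.exists_eval x (u := u) (by rw [hx.1]; trivial)
  induction t with
  | var a => exact h a
  | sup s t hs ht => simp [Tm.eval, hs, ht]
  | inf s t hs ht => simp [Tm.eval, hs, ht]

theorem exists_hom (hx : IsFreelyGenerated.{u1, 0, u2} x) {K : Type*} [Lattice K] [Countable K]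
    (f : Fin n → K) : ∃ φ : LatticeHom F K, ∀ i, φ (x i) = f i := by
  let e : Shrink.{u2} K ≃ K := (equivShrink.{u2} K).symm
  letI : Max (Shrink.{u2} K) := ⟨fun a b => e.symm (e a ⊔ e b)⟩
  letI : Min (Shrink.{u2} K) := ⟨fun a b => e.symm (e a ⊓ e b)⟩
  letI : LE (Shrink.{u2} K) := ⟨fun a b => e a ≤ e b⟩
  letI : LT (Shrink.{u2} K) := ⟨fun a b => e a < e b⟩
  letI : Lattice (Shrink.{u2} K) := Function.Injective.lattice e e.injective
    (fun {_ _} => Iff.rfl) (fun {_ _} => Iff.rfl)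
    (fun a b => e.apply_symm_apply _) (fun a b => e.apply_symm_apply _)
  obtain ⟨φ, hφ⟩ := hx.2 (Shrink.{u2} K) (fun i => e.symm (f i))
  refine ⟨⟨⟨fun u => e (φ u), fun a b => ?_⟩, fun a b => ?_⟩, fun i => ?_⟩
  · simp only [map_sup]; exact e.apply_symm_apply _
  · simp only [map_inf]; exact e.apply_symm_apply _
  · change e (φ (x i)) = f i
    rw [hφ]; exact e.apply_symm_apply _

/-- Day doubling of the interval `[p, q]`. -/
def Dbl (p q : F) : Type u1 :=
  {w : F × Prop // (w.2 → p ≤ w.1) ∧ (p ≤ w.1 → w.1 ≤ q ∨ w.2)}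

namespace Dbl
variable {p q : F}

def lvl (w : Dbl p q) : Prop := w.1.2

def pt (w : Dbl p q) : F := w.1.1

theorem lvl_imp (w : Dbl p q) : w.lvl → p ≤ w.pt := w.2.1

theorem imp_lvl (w : Dbl p q) : p ≤ w.pt → w.pt ≤ q ∨ w.lvl := w.2.2

theorem ext' {v w : Dbl p q} (h1 : v.pt = w.pt) (h2 : v.lvl ↔ w.lvl) : v = w :=
  Subtype.ext (Prod.ext h1 (propext h2))

instance : Lattice (Dbl p q) where
  le v w := v.pt ≤ w.pt ∧ (v.lvl → w.lvl)
  sup v w := ⟨(v.pt ⊔ w.pt, v.lvl ∨ w.lvl ∨ (p ≤ v.pt ⊔ w.pt ∧ ¬ v.pt ⊔ w.pt ≤ q)), by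
    constructor
    · rintro (h | h | h)
      · exact (v.lvl_imp h).trans le_sup_left
      · exact (w.lvl_imp h).trans le_sup_right
      · exact h.1
    · intro h
      by_cases h' : v.pt ⊔ w.pt ≤ q
      · exact Or.inl h'
      · exact Or.inr (Or.inr (Or.inr ⟨h, h'⟩))⟩
  inf v w := ⟨(v.pt ⊓ w.pt, v.lvl ∧ w.lvl), by
    constructor
    · rintro ⟨h1, h2⟩
      exact le_inf (v.lvl_imp h1) (w.lvl_imp h2)
    · intro h
      rcases v.imp_lvl (h.trans inf_le_left) with h1 | h1
      · exact Or.inl (inf_le_left.trans h1)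
      rcases w.imp_lvl (h.trans inf_le_right) with h2 | h2
      · exact Or.inl (inf_le_right.trans h2)
      exact Or.inr ⟨h1, h2⟩⟩
  le_refl v := ⟨le_rfl, id⟩
  le_trans u v w h1 h2 := ⟨h1.1.trans h2.1, h2.2 ∘ h1.2⟩
  le_antisymm v w h1 h2 := ext' (le_antisymm h1.1 h2.1) ⟨h1.2, h2.2⟩
  le_sup_left v w := ⟨le_sup_left (a := v.pt), Or.inl⟩
  le_sup_right v w := ⟨le_sup_right (b := w.pt), fun h => Or.inr (Or.inl h)⟩
  sup_le u v w h1 h2 := by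
    refine ⟨sup_le h1.1 h2.1, ?_⟩
    rintro (h | h | h)
    · exact h1.2 h
    · exact h2.2 h
    · rcases w.imp_lvl (h.1.trans (sup_le h1.1 h2.1)) with h3 | h3
      · exact absurd ((sup_le h1.1 h2.1).trans h3) h.2
      · exact h3
  inf_le_left v w := ⟨inf_le_left (a := v.pt), fun h => h.1⟩
  inf_le_right v w := ⟨inf_le_right (b := w.pt), fun h => h.2⟩
  le_inf u v w h1 h2 := ⟨le_inf h1.1 h2.1, fun h => ⟨h1.2 h, h2.2 h⟩⟩

def proj : LatticeHom (Dbl p q) F where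
  toFun := pt
  map_sup' _ _ := rfl
  map_inf' _ _ := rfl

end Dbl

/-- The Whitman condition. -/
theorem whitman (hx : IsFreelyGenerated.{u1, 0, u2} x) (a b c d : F) (h : a ⊓ b ≤ c ⊔ d) :
    a ≤ c ⊔ d ∨ b ≤ c ⊔ d ∨ a ⊓ b ≤ c ∨ a ⊓ b ≤ d := by
  by_contra! hcon
  obtain ⟨ha, hb, hc, hd⟩ := hcon
  haveI := countable_of_free hx
  haveI : Countable (Dbl (a ⊓ b) (c ⊔ d)) := by unfold Dbl; infer_instance
  obtain ⟨φ, hφ⟩ := exists_hom hx (K := Dbl (a ⊓ b) (c ⊔ d))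
    (fun i => ⟨(x i, a ⊓ b ≤ x i), id, Or.inr⟩)
  have hpt : ∀ u, (φ u).pt = u := by
    intro u
    refine hom_ext hx (φ := Dbl.proj.comp φ) (ψ := LatticeHom.id F) (fun i => ?_) u
    change (φ (x i)).pt = x i
    rw [hφ]; rfl
  have h1 : (φ a).lvl := by
    have := (φ a).imp_lvl
    rw [hpt] at this
    exact (this inf_le_left).resolve_left ha
  have h2 : (φ b).lvl := by
    have := (φ b).imp_lvl
    rw [hpt] at this
    exact (this inf_le_right).resolve_left hb
  have h3 : ¬ (φ c).lvl := fun h => hc (by simpa [hpt] using (φ c).lvl_imp h)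
  have h4 : ¬ (φ d).lvl := fun h => hd (by simpa [hpt] using (φ d).lvl_imp h)
  have h5 : φ a ⊓ φ b ≤ φ c ⊔ φ d := by
    rw [← map_inf, ← map_sup]
    exact OrderHomClass.mono φ h
  rcases h5.2 ⟨h1, h2⟩ with h | h | h
  · exact h3 h
  · exact h4 h
  · have := h.2
    rw [hpt, hpt] at this
    exact this le_rfl

theorem whitman_sup' (hW : ∀ a b c d : F, a ⊓ b ≤ c ⊔ d →
      a ≤ c ⊔ d ∨ b ≤ c ⊔ d ∨ a ⊓ b ≤ c ∨ a ⊓ b ≤ d) {ι : Type*} (s : Finset ι)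
    (hs : s.Nonempty) (f : ι → F) (a b : F) (h : a ⊓ b ≤ s.sup' hs f) :
    a ≤ s.sup' hs f ∨ b ≤ s.sup' hs f ∨ ∃ i ∈ s, a ⊓ b ≤ f i := by
  classical
  induction hs using Finset.Nonempty.cons_induction with
  | singleton i => exact Or.inr (Or.inr ⟨i, by simp, by simpa using h⟩)
  | cons i s hi hs ih =>
    rw [Finset.sup'_cons hs] at h ⊢
    rcases hW _ _ _ _ h with h | h | h | h
    · exact Or.inl h
    · exact Or.inr (Or.inl h)
    · exact Or.inr (Or.inr ⟨i, by simp, h⟩)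
    · rcases ih h with h | h | ⟨k, hk, h⟩
      · exact Or.inl (h.trans le_sup_right)
      · exact Or.inr (Or.inl (h.trans le_sup_right))
      · exact Or.inr (Or.inr ⟨k, by simp [hk], h⟩)

end free

/-! ### The criterion -/

section crit

variable {F : Type*} [Lattice F] {P : Set F}

theorem joinPrime {p : F} (c : ℕ → F) (hc : Monotone c) (h1 : ∀ k, ¬ p ≤ c k)
    (h2 : ∀ q ∈ P, p ≤ q ∨ ∃ k, q ≤ c k) {u v : F} (hu : u ∈ latticeClosure P)
    (hv : v ∈ latticeClosure P) (h : p ≤ u ⊔ v) : p ≤ u ∨ p ≤ v := by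
  have hs : IsSublattice {u : F | p ≤ u ∨ ∃ k, u ≤ c k} := by
    constructor
    · rintro a (ha | ⟨k, ha⟩) b (hb | ⟨l, hb⟩)
      · exact Or.inl (ha.trans le_sup_left)
      · exact Or.inl (ha.trans le_sup_left)
      · exact Or.inl (hb.trans le_sup_right)
      · exact Or.inr ⟨max k l, sup_le (ha.trans (hc (le_max_left _ _)))
          (hb.trans (hc (le_max_right _ _)))⟩
    · rintro a (ha | ⟨k, ha⟩) b (hb | ⟨l, hb⟩)
      · exact Or.inl (le_inf ha hb)
      · exact Or.inr ⟨l, inf_le_right.trans hb⟩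
      · exact Or.inr ⟨k, inf_le_left.trans ha⟩
      · exact Or.inr ⟨k, inf_le_left.trans ha⟩
  have key := latticeClosure_min (s := P) h2 hs
  rcases key hu with hu | ⟨k, hu⟩
  · exact Or.inl hu
  rcases key hv with hv | ⟨l, hv⟩
  · exact Or.inr hv
  exact absurd (h.trans (sup_le (hu.trans (hc (le_max_left k l)))
    (hv.trans (hc (le_max_right k l))))) (h1 _)

theorem eval_mem (t : Tm P) : t.eval (fun p : P => (p : F)) ∈ latticeClosure P := by
  induction t with
  | var a => exact subset_latticeClosure a.2
  | sup s t hs ht => exact isSublattice_latticeClosure.supClosed hs ht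
  | inf s t hs ht => exact isSublattice_latticeClosure.infClosed hs ht

theorem extend (hW : ∀ a b c d : F, a ⊓ b ≤ c ⊔ d →
      a ≤ c ⊔ d ∨ b ≤ c ⊔ d ∨ a ⊓ b ≤ c ∨ a ⊓ b ≤ d)
    (hJ : ∀ p ∈ P, ∀ u ∈ latticeClosure P, ∀ v ∈ latticeClosure P, p ≤ u ⊔ v → p ≤ u ∨ p ≤ v)
    (hM : ∀ p ∈ P, ∀ u ∈ latticeClosure P, ∀ v ∈ latticeClosure P, u ⊓ v ≤ p → u ≤ p ∨ v ≤ p)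
    {K : Type*} [Lattice K] (f : F → K) (hf : ∀ u ∈ P, ∀ v ∈ P, u ≤ v → f u ≤ f v) :
    ∃ φ : LatticeHom (genSub P) K, ∀ (u : F) (hu : u ∈ P),
      φ ⟨u, subset_latticeClosure hu⟩ = f u := by
  let eF : Tm P → F := Tm.eval (fun p : P => (p : F))
  let eK : Tm P → K := Tm.eval (fun p : P => f p)
  have key : ∀ s t : Tm P, eF s ≤ eF t → eK s ≤ eK t := by
    intro s
    induction s with
    | var p =>
      intro t
      induction t with
      | var q => exact fun h => hf p p.2 q q.2 h
      | sup a b iha ihb =>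
        intro h
        rcases hJ p p.2 _ (eval_mem a) _ (eval_mem b) h with h | h
        · exact (iha h).trans le_sup_left
        · exact (ihb h).trans le_sup_right
      | inf a b iha ihb =>
        intro h
        exact le_inf (iha (h.trans inf_le_left)) (ihb (h.trans inf_le_right))
    | sup a b iha ihb =>
      intro t h
      exact sup_le (iha t (le_sup_left.trans h)) (ihb t (le_sup_right.trans h))
    | inf a b iha ihb =>
      intro t
      induction t with
      | var q =>
        intro h
        rcases hM q q.2 _ (eval_mem a) _ (eval_mem b) h with h | h
        · exact inf_le_left.trans (iha (.var q) h)
        · exact inf_le_right.trans (ihb (.var q) h)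
      | inf c d ihc ihd =>
        intro h
        exact le_inf (ihc (h.trans inf_le_left)) (ihd (h.trans inf_le_right))
      | sup c d ihc ihd =>
        intro h
        rcases hW _ _ _ _ h with h | h | h | h
        · exact inf_le_left.trans (iha (.sup c d) h)
        · exact inf_le_right.trans (ihb (.sup c d) h)
        · exact (ihc h).trans le_sup_left
        · exact (ihd h).trans le_sup_right
  have hex : ∀ u : genSub P, ∃ t : Tm P, eF t = u := by
    rintro ⟨u, hu⟩
    apply Tm.exists_eval
    rw [Subtype.range_coe]
    exact hu
  choose g hg using hex
  have huniq : ∀ s t : Tm P, eF s = eF t → eK s = eK t := fun s t h =>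
    le_antisymm (key s t h.le) (key t s h.ge)
  refine ⟨⟨⟨fun u => eK (g u), fun a b => ?_⟩, fun a b => ?_⟩, fun u hu => ?_⟩
  · refine huniq _ (.sup (g a) (g b)) ?_
    rw [hg]
    change _ = eF (g a) ⊔ eF (g b)
    rw [hg, hg]; rfl
  · refine huniq _ (.inf (g a) (g b)) ?_
    rw [hg]
    change _ = eF (g a) ⊓ eF (g b)
    rw [hg, hg]; rfl
  · refine huniq _ (.var ⟨u, hu⟩) ?_
    rw [hg]; rfl

end crit

/-! ### The combinatorics of `m j` -/

section main
universe u1 u2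
variable {n : ℕ} (hn : 3 ≤ n) {F : Type u1} [Lattice F] {x : Fin n → F}
  (δ : F ≃o Fᵒᵈ)

theorem dBar_le {a b : F} : dBar δ a ≤ dBar δ b ↔ b ≤ a := by
  unfold dBar
  rw [OrderDual.ofDual_le_ofDual, δ.le_iff_le]

theorem dBar_sup (a b : F) : dBar δ (a ⊔ b) = dBar δ a ⊓ dBar δ b := by
  unfold dBar; rw [map_sup]; rfl

theorem dBar_inf (a b : F) : dBar δ (a ⊓ b) = dBar δ a ⊔ dBar δ b := by
  unfold dBar; rw [map_inf]; rfl

theorem dBar_dBar (hx : IsFreelyGenerated.{u1, 0, u2} x) (hδ : ∀ i, dBar δ (x i) = x i) (u : F) :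
    dBar δ (dBar δ u) = u := by
  let ψ : LatticeHom F F :=
    { toFun := fun u => dBar δ (dBar δ u)
      map_sup' := fun a b => by rw [dBar_sup, dBar_inf]
      map_inf' := fun a b => by rw [dBar_inf, dBar_sup] }
  refine hom_ext hx (φ := ψ) (ψ := LatticeHom.id F) (fun i => ?_) u
  change dBar δ (dBar δ (x i)) = x i
  rw [hδ, hδ]

theorem exists_two {n : ℕ} (hn : 3 ≤ n) (a : Fin n) : ∃ c d : Fin n, c ≠ d ∧ c ≠ a ∧ d ≠ a := by
  obtain ⟨c, hc, -⟩ := Fin.exists_ne_and_ne_of_two_lt a a (by omega)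
  obtain ⟨d, hd, hd'⟩ := Fin.exists_ne_and_ne_of_two_lt a c (by omega)
  exact ⟨c, d, hd'.symm, hc, hd⟩

theorem mb_le (hx : IsFreelyGenerated.{u1, 0, u2} x)
    (hδ : ∀ i, dBar δ (x i) = x i) (j : ℕ) {a b : Fin n} (h : a ≠ b) : dBar δ (freeM hn x j) ≤ x a ⊔ x b := by
  have h1 : x a ⊓ x b ≤ freeM hn x j :=
    (inf_le_inf (le_freeP x j a) (le_freeP x j b)).trans (le_freeM x hn j h)
  have h2 := (dBar_le δ).2 h1
  rwa [dBar_inf, hδ, hδ] at h2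

theorem exists_phi (hx : IsFreelyGenerated.{u1, 0, u2} x)
    (hδ : ∀ i, dBar δ (x i) = x i) (i : Fin n) : ∃ φ : LatticeHom F Prop, φ (x i) = ⊤ ∧
    (∀ k, k ≠ i → φ (x k) = ⊥) ∧ (∀ j, φ (freeM hn x j) = ⊥) ∧
    (∀ j, φ (dBar δ (freeM hn x j)) = ⊥) := by
  obtain ⟨φ, hφ⟩ := exists_hom hx (K := Prop) (fun k => k = i)
  have h0 : ∀ k, k ≠ i → φ (x k) = ⊥ := by
    intro k hk; rw [hφ]; simp [hk]
  refine ⟨φ, by rw [hφ]; simp, h0, fun j => ?_, fun j => ?_⟩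
  · rw [map_freeM]
    refine (disj_eval _ hn (fun a b hab => ?_) j).2
    by_cases ha : a = i
    · rw [h0 b (by rintro rfl; exact hab ha), inf_bot_eq]
    · rw [h0 a ha, bot_inf_eq]
  · obtain ⟨c, d, hcd, hc, hd⟩ := exists_two hn i
    have := OrderHomClass.mono φ (mb_le hn δ hx hδ j hcd)
    rw [map_sup, h0 c hc, h0 d hd, sup_bot_eq] at this
    exact le_bot_iff.1 this

theorem not_le_of_phi (hx : IsFreelyGenerated.{u1, 0, u2} x)
    (hδ : ∀ i, dBar δ (x i) = x i) {φ : LatticeHom F Prop} {a b : F} (h1 : φ a = ⊤) (h2 : φ b = ⊥) :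
    ¬ a ≤ b := by
  intro h
  have := OrderHomClass.mono φ h
  rw [h1, h2] at this
  exact this trivial

theorem e1 (hx : IsFreelyGenerated.{u1, 0, u2} x)
    (hδ : ∀ i, dBar δ (x i) = x i) (i : Fin n) (j k : ℕ) : ¬ x i ≤ freeM hn x j ⊔ dBar δ (freeM hn x k) := by
  obtain ⟨φ, h1, h2, h3, h4⟩ := exists_phi hn δ hx hδ i
  exact not_le_of_phi δ hx hδ h1 (by rw [map_sup, h3, h4, sup_bot_eq])

theorem e2 (hx : IsFreelyGenerated.{u1, 0, u2} x)
    (hδ : ∀ i, dBar δ (x i) = x i) {i a : Fin n} (h : a ≠ i) (j : ℕ) : ¬ x i ≤ x a ⊔ freeM hn x j := by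
  obtain ⟨φ, h1, h2, h3, h4⟩ := exists_phi hn δ hx hδ i
  exact not_le_of_phi δ hx hδ h1 (by rw [map_sup, h3, h2 a h, sup_bot_eq])

theorem e2' (hn : 3 ≤ n) (δ : F ≃o Fᵒᵈ) (hx : IsFreelyGenerated.{u1, 0, u2} x)
    (hδ : ∀ i, dBar δ (x i) = x i) {i a b : Fin n} (h : a ≠ i) (h' : b ≠ i) : ¬ x i ≤ x a ⊔ x b := by
  obtain ⟨φ, h1, h2, h3, h4⟩ := exists_phi hn δ hx hδ i
  exact not_le_of_phi δ hx hδ h1 (by rw [map_sup, h2 b h', h2 a h, sup_bot_eq])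

theorem e3 (hx : IsFreelyGenerated.{u1, 0, u2} x)
    (hδ : ∀ i, dBar δ (x i) = x i) (a : Fin n) (j k : ℕ) : ¬ dBar δ (freeM hn x k) ⊓ freeM hn x j ≤ x a := by
  intro h
  rw [← dBar_le δ, dBar_inf, dBar_dBar δ hx hδ, hδ] at h
  exact e1 hn δ hx hδ a k j h

theorem e3' (hx : IsFreelyGenerated.{u1, 0, u2} x)
    (hδ : ∀ i, dBar δ (x i) = x i) (a : Fin n) (j : ℕ) : ¬ freeM hn x j ≤ x a :=
  fun h => e3 hn δ hx hδ a j 0 (inf_le_right.trans h)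

theorem notN (hx : IsFreelyGenerated.{u1, 0, u2} x)
    (hδ : ∀ i, dBar δ (x i) = x i) (a : Fin n) (j k : ℕ) : ¬ dBar δ (freeM hn x k) ≤ freeP x j a := by
  obtain ⟨φ, hφ⟩ := exists_hom hx (K := MN n) MN.atom
  let ψ : LatticeHom F (MN n)ᵒᵈ :=
    { toFun := fun u => OrderDual.toDual (φ (dBar δ u))
      map_sup' := fun a b => by rw [dBar_sup, map_inf]; rfl
      map_inf' := fun a b => by rw [dBar_inf, map_sup]; rfl }
  have hψ : ∀ i, ψ (x i) = OrderDual.toDual (MN.atom i) := by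
    intro i
    change OrderDual.toDual (φ (dBar δ (x i))) = _
    rw [hδ, hφ]
  have h1 : ψ (freeM hn x k) = ⊥ := by
    rw [map_freeM]
    refine (disj_eval _ hn (fun a b hab => ?_) k).2
    simp only [hψ]
    exact MN.atom_sup hab
  have h2 : φ (dBar δ (freeM hn x k)) = ⊤ := h1
  have h3 : φ (freeP x j a) = MN.atom a := by
    rw [map_freeP x φ hn, (disj_eval (fun i => φ (x i)) hn (fun a b hab => ?_) j).1, hφ]
    simp only [hφ]
    exact MN.atom_inf hab
  intro h
  have := OrderHomClass.mono φ h
  rw [h2, h3] at this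
  exact MN.not_top_le a this

theorem whitmanM (hx : IsFreelyGenerated.{u1, 0, u2} x)
    (hδ : ∀ i, dBar δ (x i) = x i) (a b : F) (j : ℕ) (h : a ⊓ b ≤ freeM hn x j) :
    a ≤ freeM hn x j ∨ b ≤ freeM hn x j ∨ ∃ c, a ⊓ b ≤ freeP x j c := by
  rcases whitman_sup' (whitman hx) _ _ _ a b h with h | h | ⟨q, -, h⟩
  · exact Or.inl h
  · exact Or.inr (Or.inl h)
  · exact Or.inr (Or.inr ⟨q.1, h.trans inf_le_left⟩)

theorem sOfQ (hx : IsFreelyGenerated.{u1, 0, u2} x)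
    (hδ : ∀ i, dBar δ (x i) = x i) (j : ℕ) (hQ : ∀ a, ¬ freeM hn x j ≤ freeP x j a) (c d : Fin n) :
    ¬ freeP x (j + 1) c ⊓ freeP x (j + 1) d ≤ freeM hn x j := by
  have hm : ∀ c, freeM hn x j ≤ freeP x (j + 1) c := fun c => by
    rw [freeP_succ x hn]; exact le_sup_right
  have hxm : ∀ c, ¬ freeP x (j + 1) c ≤ freeM hn x j := fun c h =>
    e1 hn δ hx hδ c j 0 (((le_freeP x _ c).trans h).trans le_sup_left)
  intro h
  rcases whitmanM hn δ hx hδ _ _ _ h with h | h | ⟨a, h⟩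
  · exact hxm c h
  · exact hxm d h
  · exact hQ a ((le_inf (hm c) (hm d)).trans h)

theorem notQ (hx : IsFreelyGenerated.{u1, 0, u2} x)
    (hδ : ∀ i, dBar δ (x i) = x i) (j : ℕ) : ∀ a, ¬ freeM hn x j ≤ freeP x j a := by
  induction j with
  | zero => exact fun a => e3' hn δ hx hδ a 0
  | succ j ih =>
    intro a h
    have hS := sOfQ hn δ hx hδ j ih
    obtain ⟨c, d, hcd, hc, hd⟩ := exists_two hn a
    have h := (le_freeM x hn (j + 1) hcd).trans h
    rw [freeP_succ x hn j a] at h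
    rcases whitman hx _ _ _ _ h with h | h | h | h
    · exact e2 hn δ hx hδ hc.symm j ((le_freeP x _ c).trans h)
    · exact e2 hn δ hx hδ hd.symm j ((le_freeP x _ d).trans h)
    · refine e3' hn δ hx hδ a j (le_trans (le_inf ?_ ?_) h) <;>
        · rw [freeP_succ x hn]; exact le_sup_right
    · exact hS c d h

theorem notS (hx : IsFreelyGenerated.{u1, 0, u2} x)
    (hδ : ∀ i, dBar δ (x i) = x i) (j : ℕ) (c d : Fin n) :
    ¬ freeP x (j + 1) c ⊓ freeP x (j + 1) d ≤ freeM hn x j :=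
  sOfQ hn δ hx hδ j (notQ hn δ hx hδ j) c d

theorem notA (hx : IsFreelyGenerated.{u1, 0, u2} x)
    (hδ : ∀ i, dBar δ (x i) = x i) (j j0 : ℕ) (h0 : n = 3 → 1 ≤ j0) :
    ¬ freeM hn x (j + 1) ≤ freeM hn x j ⊔ dBar δ (freeM hn x j0) := by
  intro h
  have hm : ∀ c, freeM hn x j ≤ freeP x (j + 1) c := fun c => by
    rw [freeP_succ x hn]; exact le_sup_right
  let i : Fin n := ⟨0, by omega⟩
  let k : Fin n := ⟨1, by omega⟩
  have hik : i ≠ k := by simp [i, k]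
  have h := (le_freeM x hn (j + 1) hik).trans h
  have hxa : ∀ a, ¬ freeP x (j + 1) i ⊓ freeP x (j + 1) k ≤ x a := fun a h =>
    e3' hn δ hx hδ a j ((le_inf (hm i) (hm k)).trans h)
  rcases whitman hx _ _ _ _ h with h | h | h | h
  · exact e1 hn δ hx hδ i j j0 ((le_freeP x _ i).trans h)
  · exact e1 hn δ hx hδ k j j0 ((le_freeP x _ k).trans h)
  · exact notS hn δ hx hδ j i k h
  · by_cases h3 : n = 3
    · have h4 : dBar δ (freeM hn x j0) ≤ dBar δ (freeM hn x 1) :=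
        (dBar_le δ).2 (freeM_mono x hn (h0 h3))
      have h5 := (dBar_le δ).2 (le_freeM x hn 1 hik)
      rw [freeP_succ x hn, freeP_succ x hn, dBar_inf, dBar_sup, dBar_sup, hδ, hδ] at h5
      have h6 := (h.trans h4).trans h5
      have h7 : x i ⊓ dBar δ (freeM hn x 0) ⊔ x k ⊓ dBar δ (freeM hn x 0) ≤
          freeM hn x 0 ⊔ dBar δ (freeM hn x 0) :=
        (sup_le inf_le_right inf_le_right).trans le_sup_right
      rcases whitman hx _ _ _ _ h6 with h | h | h | h
      · exact e1 hn δ hx hδ i 0 0 ((le_freeP x _ i).trans (h.trans h7))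
      · exact e1 hn δ hx hδ k 0 0 ((le_freeP x _ k).trans (h.trans h7))
      · exact hxa _ (h.trans inf_le_left)
      · exact hxa _ (h.trans inf_le_left)
    · let l : Fin n := ⟨2, by omega⟩
      let l' : Fin n := ⟨3, by omega⟩
      have h4 := h.trans (mb_le hn δ hx hδ j0 (a := l) (b := l') (by simp [l, l']))
      rcases whitman hx _ _ _ _ h4 with h | h | h | h
      · exact e2' hn δ hx hδ (by simp [l, i]) (by simp [l', i]) ((le_freeP x _ i).trans h)
      · exact e2' hn δ hx hδ (by simp [l, k]) (by simp [l', k]) ((le_freeP x _ k).trans h)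
      · exact hxa _ h
      · exact hxa _ h

theorem notA0 (hx : IsFreelyGenerated.{u1, 0, u2} x)
    (hδ : ∀ i, dBar δ (x i) = x i) (h3 : n ≠ 3) : ¬ freeM hn x 0 ≤ dBar δ (freeM hn x 0) := by
  intro h
  let i : Fin n := ⟨0, by omega⟩
  let k : Fin n := ⟨1, by omega⟩
  let l : Fin n := ⟨2, by omega⟩
  let l' : Fin n := ⟨3, by omega⟩
  have hik : i ≠ k := by simp [i, k]
  have h : x i ⊓ x k ≤ _ := (le_freeM x hn 0 hik).trans h
  have h4 := h.trans (mb_le hn δ hx hδ 0 (a := l) (b := l') (by simp [l, l']))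
  have hxa : ∀ a, a ≠ i → a ≠ k → ¬ x i ⊓ x k ≤ x a := by
    intro a hi hk h
    rw [← dBar_le δ, dBar_inf, hδ, hδ, hδ] at h
    exact e2' hn δ hx hδ hi.symm hk.symm h
  rcases whitman hx _ _ _ _ h4 with h | h | h | h
  · exact e2' hn δ hx hδ (by simp [l, i]) (by simp [l', i]) h
  · exact e2' hn δ hx hδ (by simp [l, k]) (by simp [l', k]) h
  · exact hxa _ (by simp [l, i]) (by simp [l, k]) h
  · exact hxa _ (by simp [l', i]) (by simp [l', k]) h

theorem notB' (hx : IsFreelyGenerated.{u1, 0, u2} x)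
    (hδ : ∀ i, dBar δ (x i) = x i) (j k : ℕ) : ¬ dBar δ (freeM hn x k) ⊓ freeM hn x (j + 1) ≤ freeM hn x j := by
  induction j with
  | zero =>
    intro h
    rcases whitmanM hn δ hx hδ _ _ _ h with h | h | ⟨a, h⟩
    · refine notN hn δ hx hδ ⟨0, by omega⟩ 1 k (h.trans ?_)
      rw [freeP_succ x hn]; exact le_sup_right
    · exact notS hn δ hx hδ 0 ⟨0, by omega⟩ ⟨1, by omega⟩
        ((le_freeM x hn 1 (by simp)).trans h)
    · exact e3 hn δ hx hδ a _ _ h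
  | succ j ih =>
    intro h
    rcases whitmanM hn δ hx hδ _ _ _ h with h | h | ⟨a, h⟩
    · refine notN hn δ hx hδ ⟨0, by omega⟩ (j + 1 + 1) k (h.trans ?_)
      rw [freeP_succ x hn (j + 1)]; exact le_sup_right
    · exact notS hn δ hx hδ (j + 1) ⟨0, by omega⟩ ⟨1, by omega⟩
        ((le_freeM x hn (j + 1 + 1) (by simp)).trans h)
    · have h' := h
      rw [freeP_succ x hn j] at h'
      rcases whitman hx _ _ _ _ h' with h | h | h | h
      · rw [← freeP_succ x hn j] at h
        exact notN hn δ hx hδ _ _ _ h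
      · rw [← freeP_succ x hn j] at h
        exact notQ hn δ hx hδ (j + 1) a ((freeM_mono x hn (Nat.le_succ _)).trans h)
      · exact e3 hn δ hx hδ a _ _ h
      · exact ih ((inf_le_inf le_rfl (freeM_mono x hn (Nat.le_succ _))).trans h)

theorem notB (hx : IsFreelyGenerated.{u1, 0, u2} x)
    (hδ : ∀ i, dBar δ (x i) = x i) (j k : ℕ) :
    ¬ dBar δ (freeM hn x j) ≤ freeM hn x k ⊔ dBar δ (freeM hn x (j + 1)) := by
  intro h
  rw [← dBar_le δ, dBar_sup, dBar_dBar δ hx hδ, dBar_dBar δ hx hδ] at h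
  exact notB' hn δ hx hδ j k h

theorem hJ_main (hx : IsFreelyGenerated.{u1, 0, u2} x)
    (hδ : ∀ i, dBar δ (x i) = x i) : ∀ p ∈ pSet hn x δ, ∀ u ∈ latticeClosure (pSet hn x δ),
    ∀ v ∈ latticeClosure (pSet hn x δ), p ≤ u ⊔ v → p ≤ u ∨ p ≤ v := by
  rintro p ⟨j, hj, rfl | rfl⟩ u hu v hv h
  · cases j with
    | zero =>
      have h3 : n ≠ 3 := fun h => by have := hj h; omega
      refine joinPrime (fun _ => dBar δ (freeM hn x 0)) monotone_const
        (fun _ => notA0 hn δ hx hδ h3) ?_ hu hv h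
      rintro q ⟨k, hk, rfl | rfl⟩
      · exact Or.inl (freeM_mono x hn (Nat.zero_le _))
      · exact Or.inr ⟨0, (dBar_le δ).2 (freeM_mono x hn (Nat.zero_le _))⟩
    | succ j =>
      obtain ⟨j0, h0, h0'⟩ : ∃ j0, (n = 3 → 1 ≤ j0) ∧ ∀ k, (n = 3 → 1 ≤ k) → j0 ≤ k := by
        by_cases h3 : n = 3
        · exact ⟨1, fun _ => le_rfl, fun k hk => hk h3⟩
        · exact ⟨0, fun h => absurd h h3, fun k _ => Nat.zero_le k⟩
      refine joinPrime (fun _ => freeM hn x j ⊔ dBar δ (freeM hn x j0)) monotone_const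
        (fun _ => notA hn δ hx hδ j j0 h0) ?_ hu hv h
      rintro q ⟨k, hk, rfl | rfl⟩
      · rcases Nat.lt_or_ge k (j + 1) with hlt | hge
        · exact Or.inr ⟨0, (freeM_mono x hn (Nat.le_of_lt_succ hlt)).trans le_sup_left⟩
        · exact Or.inl (freeM_mono x hn hge)
      · exact Or.inr ⟨0, ((dBar_le δ).2 (freeM_mono x hn (h0' k hk))).trans le_sup_right⟩
  · refine joinPrime (fun k => freeM hn x k ⊔ dBar δ (freeM hn x (j + 1)))
      (fun a b hab => sup_le_sup (freeM_mono x hn hab) le_rfl)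
      (fun k => notB hn δ hx hδ j k) ?_ hu hv h
    rintro q ⟨k, hk, rfl | rfl⟩
    · exact Or.inr ⟨k, le_sup_left⟩
    · rcases Nat.lt_or_ge j k with hlt | hge
      · exact Or.inr ⟨0, ((dBar_le δ).2 (freeM_mono x hn hlt)).trans le_sup_right⟩
      · exact Or.inl ((dBar_le δ).2 (freeM_mono x hn hge))

theorem dBar_mem (hx : IsFreelyGenerated.{u1, 0, u2} x)
    (hδ : ∀ i, dBar δ (x i) = x i) {u : F} (hu : u ∈ latticeClosure (pSet hn x δ)) :
    dBar δ u ∈ latticeClosure (pSet hn x δ) := by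
  have hs : IsSublattice {u : F | dBar δ u ∈ latticeClosure (pSet hn x δ)} := by
    constructor
    · intro a ha b hb
      change dBar δ (a ⊔ b) ∈ latticeClosure (pSet hn x δ)
      rw [dBar_sup]
      exact isSublattice_latticeClosure.infClosed ha hb
    · intro a ha b hb
      change dBar δ (a ⊓ b) ∈ latticeClosure (pSet hn x δ)
      rw [dBar_inf]
      exact isSublattice_latticeClosure.supClosed ha hb
  refine latticeClosure_min ?_ hs hu
  rintro q ⟨k, hk, rfl | rfl⟩
  · exact subset_latticeClosure ⟨k, hk, Or.inr rfl⟩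
  · exact subset_latticeClosure ⟨k, hk, Or.inl (dBar_dBar δ hx hδ _)⟩

theorem hM_main (hx : IsFreelyGenerated.{u1, 0, u2} x)
    (hδ : ∀ i, dBar δ (x i) = x i) : ∀ p ∈ pSet hn x δ, ∀ u ∈ latticeClosure (pSet hn x δ),
    ∀ v ∈ latticeClosure (pSet hn x δ), u ⊓ v ≤ p → u ≤ p ∨ v ≤ p := by
  intro p hp u hu v hv h
  rw [← dBar_le δ, dBar_inf] at h
  have hp' : dBar δ p ∈ pSet hn x δ := by
    obtain ⟨k, hk, rfl | rfl⟩ := hp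
    · exact ⟨k, hk, Or.inr rfl⟩
    · exact ⟨k, hk, Or.inl (dBar_dBar δ hx hδ _)⟩
  rcases hJ_main hn δ hx hδ _ hp' _ (dBar_mem hn δ hx hδ hu) _ (dBar_mem hn δ hx hδ hv) h with h | h
  · exact Or.inl ((dBar_le δ).1 h)
  · exact Or.inr ((dBar_le δ).1 h)

end main

end PFree

theorem pSet_completely_freely_generates {n : ℕ} (hn : 3 ≤ n)
    {F : Type*} [Lattice F] (x : Fin n → F) (hx : IsFreelyGenerated x)
    (δ : F ≃o Fᵒᵈ) (hδ : ∀ i, dBar δ (x i) = x i) :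
    ∀ (K : Type*) [Lattice K] (f : F → K),
      (∀ u ∈ pSet hn x δ, ∀ v ∈ pSet hn x δ, u ≤ v → f u ≤ f v) →
      ∃ φ : LatticeHom (genSub (pSet hn x δ)) K,
        ∀ (u : F) (hu : u ∈ pSet hn x δ), φ ⟨u, subset_latticeClosure hu⟩ = f u := by
  intro K _ f hf
  exact PFree.extend (PFree.whitman hx) (PFree.hJ_main hn δ hx hδ) (PFree.hM_main hn δ hx hδ) f hf
end

section
/- Let κ be a cardinal that is either ℵ₀ or an even natural number at least 4, let 3 ≤ n ∈ ℕ, and let G be a lattice freely generated by a family y : ρ → G with #ρ = κ. Then there exists a totally symmetric embedding τ : G → F whose range is contained in the sublattice of F generated by the set {a, ā, b, b̄}. -/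
open Cardinal

universe u

/-- An element `u` of a lattice is symmetric if it is fixed by every automorphism. -/
def IsSymmElem {F : Type*} [Lattice F] (u : F) : Prop := ∀ π : F ≃o F, π u = u

/-- A totally symmetric embedding of `G` into `F` (with natural dual automorphism `δ`):
an injective lattice homomorphism whose range is selfdually positioned and consists of
symmetric elements. -/
def IsTotallySymmetricEmbedding {G F : Type*} [Lattice G] [Lattice F]
    (δ : F ≃o Fᵒᵈ) (φ : LatticeHom G F) : Prop :=
  Function.Injective φ ∧ SelfduallyPositioned δ (Set.range ⇑φ) ∧
    ∀ u ∈ Set.range ⇑φ, IsSymmElem u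

/-- The element `a := m 1 ⊔ (m 3)̄`. -/
def aElem {n : ℕ} {F : Type*} [Lattice F] (hn : 3 ≤ n) (x : Fin n → F) (δ : F ≃o Fᵒᵈ) : F :=
  freeM hn x 1 ⊔ dBar δ (freeM hn x 3)

/-- The element `b := m 2 ⊔ (m 4)̄`. -/
def bElem {n : ℕ} {F : Type*} [Lattice F] (hn : 3 ≤ n) (x : Fin n → F) (δ : F ≃o Fᵒᵈ) : F :=
  freeM hn x 2 ⊔ dBar δ (freeM hn x 4)


namespace TSE

/-- Lattice terms. -/
inductive LTerm (σ : Type*) where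
  | var : σ → LTerm σ
  | sup : LTerm σ → LTerm σ → LTerm σ
  | inf : LTerm σ → LTerm σ → LTerm σ

/-- Evaluation of a term in a lattice. -/
def ev {σ : Type*} {K : Type*} [Lattice K] (f : σ → K) : LTerm σ → K
  | .var i => f i
  | .sup s t => ev f s ⊔ ev f t
  | .inf s t => ev f s ⊓ ev f t

/-- Substitution. -/
def sub {σ τ : Type*} (g : σ → LTerm τ) : LTerm σ → LTerm τ
  | .var i => g i
  | .sup s t => .sup (sub g s) (sub g t)
  | .inf s t => .inf (sub g s) (sub g t)

/-- Dual term, with the variables renamed by `w`. -/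
def dualT {σ : Type*} (w : σ → σ) : LTerm σ → LTerm σ
  | .var i => .var (w i)
  | .sup s t => .inf (dualT w s) (dualT w t)
  | .inf s t => .sup (dualT w s) (dualT w t)

theorem ev_sub {σ τ K : Type*} [Lattice K] (f : τ → K) (g : σ → LTerm τ) (t : LTerm σ) :
    ev f (sub g t) = ev (fun i => ev f (g i)) t := by
  induction t with
  | var i => rfl
  | sup s t hs ht => simp [sub, ev, hs, ht]
  | inf s t hs ht => simp [sub, ev, hs, ht]

theorem dualT_sub {σ τ : Type*} (g : σ → LTerm τ) (w : σ → σ) (w' : τ → τ)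
    (h : ∀ i, dualT w' (g i) = g (w i)) (t : LTerm σ) :
    dualT w' (sub g t) = sub g (dualT w t) := by
  induction t with
  | var i => exact h i
  | sup s t hs ht => simp [sub, dualT, hs, ht]
  | inf s t hs ht => simp [sub, dualT, hs, ht]

theorem map_ev {σ K L : Type*} [Lattice K] [Lattice L] (φ : LatticeHom K L) (f : σ → K)
    (t : LTerm σ) : φ (ev f t) = ev (fun i => φ (f i)) t := by
  induction t with
  | var i => rfl
  | sup s t hs ht => simp [ev, hs, ht]
  | inf s t hs ht => simp [ev, hs, ht]

theorem ev_mem {σ K : Type*} [Lattice K] (f : σ → K) {S : Set K} (hS : IsSublattice S)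
    (h : ∀ i, f i ∈ S) (t : LTerm σ) : ev f t ∈ S := by
  induction t with
  | var i => exact h i
  | sup s t hs ht => exact hS.supClosed hs ht
  | inf s t hs ht => exact hS.infClosed hs ht

theorem isSublattice_range_ev {σ K : Type*} [Lattice K] (f : σ → K) :
    IsSublattice (Set.range (ev f)) where
  supClosed := by
    rintro _ ⟨s, rfl⟩ _ ⟨t, rfl⟩
    exact ⟨.sup s t, rfl⟩
  infClosed := by
    rintro _ ⟨s, rfl⟩ _ ⟨t, rfl⟩
    exact ⟨.inf s t, rfl⟩

theorem exists_ev {σ K : Type*} [Lattice K] (f : σ → K)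
    (h : latticeClosure (Set.range f) = Set.univ) (u : K) : ∃ t, ev f t = u := by
  have : latticeClosure (Set.range f) ⊆ Set.range (ev f) := by
    apply latticeClosure_min
    · rintro _ ⟨i, rfl⟩
      exact ⟨.var i, rfl⟩
    · exact isSublattice_range_ev f
  rw [h] at this
  exact this (Set.mem_univ u)

/-- A small lattice is isomorphic to one in the smaller universe. -/
theorem exists_small_lattice.{v, w} (S : Type w) [Lattice S] [Small.{v} S] :
    ∃ (K : Type v) (_ : Lattice K), Nonempty (K ≃o S) := by
  let e : Shrink.{v} S ≃ S := (equivShrink S).symm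
  let i1 : Max (Shrink.{v} S) := ⟨fun a b => e.symm (e a ⊔ e b)⟩
  let i2 : Min (Shrink.{v} S) := ⟨fun a b => e.symm (e a ⊓ e b)⟩
  let i3 : LE (Shrink.{v} S) := ⟨fun a b => e a ≤ e b⟩
  let i4 : LT (Shrink.{v} S) := ⟨fun a b => e a < e b⟩
  refine ⟨Shrink.{v} S, Function.Injective.lattice e e.injective Iff.rfl Iff.rfl
    (fun a b => e.apply_symm_apply _) (fun a b => e.apply_symm_apply _), ⟨⟨e, Iff.rfl⟩⟩⟩

/-- Universe change for the universal property. -/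
theorem up_universe.{v, w} {F ι : Type*} [Lattice F] [Countable ι] (x : ι → F)
    (h : ∀ (K : Type v) [Lattice K] (f : ι → K), ∃ φ : LatticeHom F K, ∀ i, φ (x i) = f i)
    (K : Type w) [Lattice K] (f : ι → K) : ∃ φ : LatticeHom F K, ∀ i, φ (x i) = f i := by
  let g : Shrink.{v} ι → K := fun i => f ((equivShrink.{v} ι).symm i)
  let S : Sublattice K := ⟨Set.range (ev g), (isSublattice_range_ev g).supClosed,
    (isSublattice_range_ev g).infClosed⟩
  have : Small.{v} S := small_range (ev g)
  obtain ⟨K', _, ⟨e⟩⟩ := exists_small_lattice.{v} S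
  let f' : ι → S := fun i => ⟨f i, ⟨.var (equivShrink.{v} ι i), by simp [ev, g]⟩⟩
  obtain ⟨φ, hφ⟩ := h K' (fun i => e.symm (f' i))
  refine ⟨S.subtype.comp ((e : LatticeHom K' S).comp φ), fun i => ?_⟩
  simp [hφ, f']

/-- Whitman's condition. -/
def Whit (L : Type*) [Lattice L] : Prop :=
  ∀ u v s t : L, u ⊓ v ≤ s ⊔ t → u ≤ s ⊔ t ∨ v ≤ s ⊔ t ∨ u ⊓ v ≤ s ∨ u ⊓ v ≤ t

/-- Day's doubling of the interval `[c, d]`. -/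
def Dbl {F : Type*} [Lattice F] (c d : F) : Type _ :=
  {a : F × Prop // (a.2 → c ≤ a.1) ∧ (c ≤ a.1 → ¬ a.1 ≤ d → a.2)}

instance {F : Type*} [Lattice F] (c d : F) : PartialOrder (Dbl c d) :=
  inferInstanceAs (PartialOrder
    {a : F × Prop // (a.2 → c ≤ a.1) ∧ (c ≤ a.1 → ¬ a.1 ≤ d → a.2)})

instance {F : Type*} [Lattice F] (c d : F) : Lattice (Dbl c d) where
  sup a b := ⟨(a.1.1 ⊔ b.1.1, a.1.2 ∨ b.1.2 ∨ (c ≤ a.1.1 ⊔ b.1.1 ∧ ¬ a.1.1 ⊔ b.1.1 ≤ d)), by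
    refine ⟨?_, fun h1 h2 => Or.inr (Or.inr ⟨h1, h2⟩)⟩
    rintro (h | h | h)
    · exact le_sup_of_le_left (a.2.1 h)
    · exact le_sup_of_le_right (b.2.1 h)
    · exact h.1⟩
  inf a b := ⟨(a.1.1 ⊓ b.1.1, a.1.2 ∧ b.1.2), by
    refine ⟨fun h => le_inf (a.2.1 h.1) (b.2.1 h.2), fun h1 h2 => ?_⟩
    have h1' := le_inf_iff.1 h1
    exact ⟨a.2.2 h1'.1 fun h => h2 (inf_le_of_left_le h),
      b.2.2 h1'.2 fun h => h2 (inf_le_of_right_le h)⟩⟩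
  le_sup_left a b := ⟨le_sup_left, fun h => Or.inl h⟩
  le_sup_right a b := ⟨le_sup_right, fun h => Or.inr (Or.inl h)⟩
  sup_le a b e hae hbe := by
    refine ⟨sup_le hae.1 hbe.1, ?_⟩
    rintro (h | h | h)
    · exact hae.2 h
    · exact hbe.2 h
    · exact e.2.2 (h.1.trans (sup_le hae.1 hbe.1)) fun h' => h.2 ((sup_le hae.1 hbe.1).trans h')
  inf_le_left a b := ⟨inf_le_left, fun h => h.1⟩
  inf_le_right a b := ⟨inf_le_right, fun h => h.2⟩
  le_inf a b e h1 h2 := ⟨le_inf h1.1 h2.1, fun h => ⟨h1.2 h, h2.2 h⟩⟩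

/-- Projection of the doubling. -/
def Dbl.fst {F : Type*} [Lattice F] (c d : F) : LatticeHom (Dbl c d) F where
  toFun a := a.1.1
  map_sup' _ _ := rfl
  map_inf' _ _ := rfl

section Free

variable {F ι : Type*} [Lattice F] (x : ι → F)

theorem exists_lift (hgen : latticeClosure (Set.range x) = Set.univ)
    (h : ∀ c d : F, ∀ f : ι → Dbl c d, ∃ φ : LatticeHom F (Dbl c d), ∀ i, φ (x i) = f i)
    (c d : F) : ∃ φ : LatticeHom F (Dbl c d), (∀ u, (φ u).1.1 = u) ∧
      ∀ i, (φ (x i)).1.2 ↔ c ≤ x i := by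
  obtain ⟨φ, hφ⟩ := h c d (fun i => ⟨(x i, c ≤ x i), fun h => h, fun h _ => h⟩)
  refine ⟨φ, fun u => ?_, fun i => by rw [hφ]⟩
  obtain ⟨t, rfl⟩ := exists_ev x hgen u
  have := map_ev ((Dbl.fst c d).comp φ) x t
  have h2 : (fun i => ((Dbl.fst c d).comp φ) (x i)) = x := by
    funext i
    simp [hφ, Dbl.fst]
  rw [h2] at this
  exact this

theorem whit_of_free (hgen : latticeClosure (Set.range x) = Set.univ)
    (h : ∀ c d : F, ∀ f : ι → Dbl c d, ∃ φ : LatticeHom F (Dbl c d), ∀ i, φ (x i) = f i) :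
    Whit F := by
  intro u v s t hle
  by_contra! hcon
  obtain ⟨h1, h2, h3, h4⟩ := hcon
  obtain ⟨φ, hφ, -⟩ := exists_lift x hgen h (u ⊓ v) (s ⊔ t)
  have hu : (φ u).1.2 := (φ u).2.2 (by rw [hφ]; exact inf_le_left) (by rwa [hφ])
  have hv : (φ v).1.2 := (φ v).2.2 (by rw [hφ]; exact inf_le_right) (by rwa [hφ])
  have hs : ¬ (φ s).1.2 := fun h' => h3 (by simpa [hφ] using (φ s).2.1 h')
  have ht : ¬ (φ t).1.2 := fun h' => h4 (by simpa [hφ] using (φ t).2.1 h')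
  have hm : φ (u ⊓ v) ≤ φ (s ⊔ t) := OrderHomClass.mono φ hle
  have hc : (φ (u ⊓ v)).1.2 := by rw [map_inf]; exact ⟨hu, hv⟩
  have hd := hm.2 hc
  rw [map_sup] at hd
  rcases hd with hd | hd | hd
  · exact hs hd
  · exact ht hd
  · rw [hφ, hφ] at hd
    exact hd.2 le_rfl

theorem jp_of_free (hgen : latticeClosure (Set.range x) = Set.univ)
    (h : ∀ c d : F, ∀ f : ι → Dbl c d, ∃ φ : LatticeHom F (Dbl c d), ∀ i, φ (x i) = f i)
    (i : ι) (s t : F) (hle : x i ≤ s ⊔ t) : x i ≤ s ∨ x i ≤ t := by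
  by_contra! hcon
  obtain ⟨h3, h4⟩ := hcon
  obtain ⟨φ, hφ, hx⟩ := exists_lift x hgen h (x i) (s ⊔ t)
  have hs : ¬ (φ s).1.2 := fun h' => h3 (by simpa [hφ] using (φ s).2.1 h')
  have ht : ¬ (φ t).1.2 := fun h' => h4 (by simpa [hφ] using (φ t).2.1 h')
  have hm : φ (x i) ≤ φ (s ⊔ t) := OrderHomClass.mono φ hle
  have hd := hm.2 ((hx i).2 le_rfl)
  rw [map_sup] at hd
  rcases hd with hd | hd | hd
  · exact hs hd
  · exact ht hd
  · rw [hφ, hφ] at hd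
    exact hd.2 le_rfl

end Free

/-! ### The independence criterion -/

/-- Every member of the family can be separated from the others by an ideal. -/
def Low {σ L : Type*} [Lattice L] (f : σ → L) : Prop :=
  ∀ i, ∃ I : Set L, IsLowerSet I ∧ SupClosed I ∧ (∀ j, j ≠ i → f j ∈ I) ∧ f i ∉ I

/-- Every member of the family can be separated from the others by a filter. -/
def Upp {σ L : Type*} [Lattice L] (f : σ → L) : Prop :=
  ∀ i, ∃ I : Set L, IsUpperSet I ∧ InfClosed I ∧ (∀ j, j ≠ i → f j ∈ I) ∧ f i ∉ I

section Crit

variable {σ L : Type*} [Lattice L] {f : σ → L}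

theorem low_ev (hl : Low f) (i : σ) : ∃ I : Set L, IsLowerSet I ∧ SupClosed I ∧ f i ∉ I ∧
    (∀ j, j ≠ i → f j ∈ I) ∧ ∀ t, f i ≤ ev f t ∨ ev f t ∈ I := by
  obtain ⟨I, h1, h2, h3, h4⟩ := hl i
  refine ⟨I, h1, h2, h4, h3, fun t => ?_⟩
  induction t with
  | var j =>
    by_cases h : j = i
    · subst h; exact Or.inl le_rfl
    · exact Or.inr (h3 j h)
  | sup s t hs ht =>
    rcases hs with hs | hs
    · exact Or.inl (le_sup_of_le_left hs)
    rcases ht with ht | ht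
    · exact Or.inl (le_sup_of_le_right ht)
    exact Or.inr (h2 hs ht)
  | inf s t hs ht =>
    rcases hs with hs | hs
    · rcases ht with ht | ht
      · exact Or.inl (le_inf hs ht)
      · exact Or.inr (h1 inf_le_right ht)
    · exact Or.inr (h1 inf_le_left hs)

theorem low_jp (hl : Low f) (i : σ) (s t : LTerm σ) (h : f i ≤ ev f s ⊔ ev f t) :
    f i ≤ ev f s ∨ f i ≤ ev f t := by
  obtain ⟨I, h1, h2, h3, -, h4⟩ := low_ev hl i
  by_contra! hc
  exact h3 (h1 h (h2 ((h4 s).resolve_left hc.1) ((h4 t).resolve_left hc.2)))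

theorem low_inj (hl : Low f) (i j : σ) (h : f i ≤ f j) : i = j := by
  obtain ⟨I, h1, h2, h3, h4, -⟩ := low_ev hl i
  by_contra hc
  exact h3 (h1 h (h4 j (Ne.symm hc)))

theorem upp_mp (hl : Upp f) (i : σ) (s t : LTerm σ) (h : ev f s ⊓ ev f t ≤ f i) :
    ev f s ≤ f i ∨ ev f t ≤ f i := by
  obtain ⟨I, h1, h2, h3, h4⟩ := hl i
  have key : ∀ t, ev f t ≤ f i ∨ ev f t ∈ I := by
    intro t
    induction t with
    | var j =>
      by_cases h : j = i
      · subst h; exact Or.inl le_rfl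
      · exact Or.inr (h3 j h)
    | inf s t hs ht =>
      rcases hs with hs | hs
      · exact Or.inl (inf_le_of_left_le hs)
      rcases ht with ht | ht
      · exact Or.inl (inf_le_of_right_le ht)
      exact Or.inr (h2 hs ht)
    | sup s t hs ht =>
      rcases hs with hs | hs
      · rcases ht with ht | ht
        · exact Or.inl (sup_le hs ht)
        · exact Or.inr (h1 le_sup_right ht)
      · exact Or.inr (h1 le_sup_left hs)
  by_contra! hc
  exact h4 (h1 h (h2 ((key s).resolve_left hc.1) ((key t).resolve_left hc.2)))

/-- The freeness criterion. -/
theorem crit (hW : Whit L) (hl : Low f) (hu : Upp f) {K : Type*} [Lattice K] (y : σ → K)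
    (s : LTerm σ) : ∀ t, ev f s ≤ ev f t → ev y s ≤ ev y t := by
  induction s with
  | var i =>
    intro t
    induction t with
    | var j =>
      intro h
      rw [low_inj hl i j h]
    | sup a b ha hb =>
      intro h
      rcases low_jp hl i a b h with h | h
      · exact le_sup_of_le_left (ha h)
      · exact le_sup_of_le_right (hb h)
    | inf a b ha hb =>
      intro h
      exact le_inf (ha (h.trans inf_le_left)) (hb (h.trans inf_le_right))
  | sup a b ha hb =>
    intro t h
    exact sup_le (ha t (le_sup_left.trans h)) (hb t (le_sup_right.trans h))
  | inf p q hp hq =>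
    intro t
    induction t with
    | var j =>
      intro h
      rcases upp_mp hu j p q h with h | h
      · exact inf_le_of_left_le (hp (.var j) h)
      · exact inf_le_of_right_le (hq (.var j) h)
    | sup a b ha hb =>
      intro h
      rcases hW _ _ _ _ h with h | h | h | h
      · exact inf_le_of_left_le (hp (.sup a b) h)
      · exact inf_le_of_right_le (hq (.sup a b) h)
      · exact le_sup_of_le_left (ha h)
      · exact le_sup_of_le_right (hb h)
    | inf a b ha hb =>
      intro h
      exact le_inf (ha (h.trans inf_le_left)) (hb (h.trans inf_le_right))

/-- Whitman's algorithm with fuel (answers `true` when out of fuel). -/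
def wle [DecidableEq σ] : ℕ → LTerm σ → LTerm σ → Bool
  | 0, _, _ => true
  | n + 1, .sup a b, t => wle n a t && wle n b t
  | n + 1, .var i, .inf a b => wle n (.var i) a && wle n (.var i) b
  | n + 1, .inf p q, .inf a b => wle n (.inf p q) a && wle n (.inf p q) b
  | _ + 1, .var i, .var j => decide (i = j)
  | n + 1, .var i, .sup a b => wle n (.var i) a || wle n (.var i) b
  | n + 1, .inf p q, .var j => wle n p (.var j) || wle n q (.var j)
  | n + 1, .inf p q, .sup a b => wle n p (.sup a b) || wle n q (.sup a b) ||
      wle n (.inf p q) a || wle n (.inf p q) b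

theorem wle_of_le [DecidableEq σ] (hW : Whit L) (hl : Low f) (hu : Upp f) (n : ℕ) :
    ∀ s t : LTerm σ, ev f s ≤ ev f t → wle n s t = true := by
  induction n with
  | zero => intro s t _; simp [wle]
  | succ n ih =>
    intro s t h
    cases s with
    | sup a b =>
      simp only [wle, Bool.and_eq_true]
      exact ⟨ih _ _ (le_sup_left.trans h), ih _ _ (le_sup_right.trans h)⟩
    | var i =>
      cases t with
      | var j => simpa [wle] using low_inj hl i j h
      | inf a b =>
        simp only [wle, Bool.and_eq_true]
        exact ⟨ih _ _ (h.trans inf_le_left), ih _ _ (h.trans inf_le_right)⟩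
      | sup a b =>
        simp only [wle, Bool.or_eq_true]
        exact (low_jp hl i a b h).imp (ih (.var i) _) (ih (.var i) _)
    | inf p q =>
      cases t with
      | var j =>
        simp only [wle, Bool.or_eq_true]
        exact (upp_mp hu j p q h).imp (ih _ (.var j)) (ih _ (.var j))
      | inf a b =>
        simp only [wle, Bool.and_eq_true]
        exact ⟨ih _ _ (h.trans inf_le_left), ih _ _ (h.trans inf_le_right)⟩
      | sup a b =>
        simp only [wle, Bool.or_eq_true]
        rcases hW _ _ _ _ h with h | h | h | h
        · exact Or.inl (Or.inl (Or.inl (ih _ (.sup a b) h)))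
        · exact Or.inl (Or.inl (Or.inr (ih _ (.sup a b) h)))
        · exact Or.inl (Or.inr (ih (.inf p q) _ h))
        · exact Or.inr (ih (.inf p q) _ h)

end Crit

/-! ### Duality -/

section Dual

variable {F : Type*} [Lattice F] (δ : F ≃o Fᵒᵈ)

theorem dBar_le_dBar {u v : F} : dBar δ u ≤ dBar δ v ↔ v ≤ u := by
  unfold dBar
  rw [OrderDual.ofDual_le_ofDual, δ.le_iff_le]

theorem dBar_sup (u v : F) : dBar δ (u ⊔ v) = dBar δ u ⊓ dBar δ v := by
  unfold dBar
  rw [map_sup]; rfl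

theorem dBar_inf (u v : F) : dBar δ (u ⊓ v) = dBar δ u ⊔ dBar δ v := by
  unfold dBar
  rw [map_inf]; rfl

theorem dBar_ev {σ : Type*} (f : σ → F) (w : σ → σ) (h : ∀ i, dBar δ (f i) = f (w i))
    (t : LTerm σ) : dBar δ (ev f t) = ev f (dualT w t) := by
  induction t with
  | var i => exact h i
  | sup s t hs ht => simp [ev, dualT, dBar_sup, hs, ht]
  | inf s t hs ht => simp [ev, dualT, dBar_inf, hs, ht]

theorem dualT_id_id {σ : Type*} (w : σ → σ) (hw : ∀ i, w (w i) = i) (t : LTerm σ) :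
    dualT w (dualT w t) = t := by
  induction t with
  | var i => simp [dualT, hw]
  | sup s t hs ht => simp [dualT, hs, ht]
  | inf s t hs ht => simp [dualT, hs, ht]

theorem dBar_dBar {ι : Type*} (x : ι → F) (hgen : latticeClosure (Set.range x) = Set.univ)
    (hδ : ∀ i, dBar δ (x i) = x i) (u : F) : dBar δ (dBar δ u) = u := by
  obtain ⟨t, rfl⟩ := exists_ev x hgen u
  rw [dBar_ev δ x id hδ, dBar_ev δ x id hδ, dualT_id_id id (fun _ => rfl)]

theorem upp_of_low {σ : Type*} (f : σ → F) (w : σ → σ) (hw : ∀ i, w (w i) = i)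
    (h : ∀ i, dBar δ (f i) = f (w i)) (hl : Low f) : Upp f := by
  intro i
  obtain ⟨I, h1, h2, h3, h4⟩ := hl (w i)
  refine ⟨{u | dBar δ u ∈ I}, ?_, ?_, ?_, ?_⟩
  · intro u v huv hu
    exact h1 ((dBar_le_dBar δ).2 huv) hu
  · intro u hu v hv
    show dBar δ (u ⊓ v) ∈ I
    rw [dBar_inf]
    exact h2 hu hv
  · intro j hj
    show dBar δ (f j) ∈ I
    rw [h]
    exact h3 _ fun hc => hj (by rw [← hw j, hc, hw])
  · show ¬ dBar δ (f i) ∈ I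
    rwa [h]

theorem low_of_le {σ : Type*} {f : σ → F}
    (h : ∀ i, ∃ r, (∀ j, j ≠ i → f j ≤ r) ∧ ¬ f i ≤ r) : Low f := by
  intro i
  obtain ⟨r, h1, h2⟩ := h i
  exact ⟨Set.Iic r, isLowerSet_Iic r, fun u hu v hv => sup_le hu hv, h1, h2⟩

end Dual

/-! ### Finite versions of Whitman's condition -/

section WFin

variable {F : Type*} [Lattice F]

theorem whit_inf' (hW : Whit F) {α : Type*} (S : Finset α) (hS : S.Nonempty) (f : α → F)
    (s t : F) (h : S.inf' hS f ≤ s ⊔ t) :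
    (∃ i ∈ S, f i ≤ s ⊔ t) ∨ S.inf' hS f ≤ s ∨ S.inf' hS f ≤ t := by
  induction hS using Finset.Nonempty.cons_induction with
  | singleton a => exact Or.inl ⟨a, by simp, by simpa using h⟩
  | cons a S ha hS ih =>
    rw [Finset.inf'_cons hS] at h ⊢
    rcases hW _ _ _ _ h with h | h | h | h
    · exact Or.inl ⟨a, by simp, h⟩
    · rcases ih h with ⟨i, hi, h⟩ | h | h
      · exact Or.inl ⟨i, by simp [hi], h⟩
      · exact Or.inr (Or.inl (inf_le_of_right_le h))
      · exact Or.inr (Or.inr (inf_le_of_right_le h))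
    · exact Or.inr (Or.inl h)
    · exact Or.inr (Or.inr h)

theorem whit_fin' (hW : Whit F) {α β : Type*} (S : Finset α) (hS : S.Nonempty) (f : α → F)
    (T : Finset β) (hT : T.Nonempty) (g : β → F) (h : S.inf' hS f ≤ T.sup' hT g) :
    (∃ i ∈ S, f i ≤ T.sup' hT g) ∨ ∃ i ∈ T, S.inf' hS f ≤ g i := by
  induction hT using Finset.Nonempty.cons_induction with
  | singleton a => exact Or.inr ⟨a, by simp, by simpa using h⟩
  | cons a T ha hT ih =>
    rw [Finset.sup'_cons hT] at h ⊢
    rcases whit_inf' hW S hS f _ _ h with h | h | h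
    · exact Or.inl h
    · exact Or.inr ⟨a, by simp, h⟩
    · rcases ih h with ⟨i, hi, h⟩ | ⟨i, hi, h⟩
      · exact Or.inl ⟨i, hi, le_sup_of_le_right h⟩
      · exact Or.inr ⟨i, by simp [hi], h⟩

theorem whit_fin (hW : Whit F) {S T : Set F} (hS : S.Finite) (hS' : S.Nonempty)
    (hT : T.Finite) (hT' : T.Nonempty) {c d : F} (hc : IsGLB S c) (hd : IsLUB T d)
    (h : c ≤ d) : (∃ s ∈ S, s ≤ d) ∨ ∃ t ∈ T, c ≤ t := by
  lift S to Finset F using hS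
  lift T to Finset F using hT
  have hS'' : S.Nonempty := hS'
  have hT'' : T.Nonempty := hT'
  obtain rfl : c = S.inf' hS'' id := hc.unique (by
    refine ⟨fun a ha => Finset.inf'_le id ha, fun b hb => Finset.le_inf' _ _ fun a ha => hb ha⟩)
  obtain rfl : d = T.sup' hT'' id := hd.unique (by
    refine ⟨fun a ha => Finset.le_sup' id ha, fun b hb => Finset.sup'_le _ _ fun a ha => hb ha⟩)
  exact whit_fin' hW S hS'' id T hT'' id h

theorem jp_fin {c : F} (hc : ∀ s t, c ≤ s ⊔ t → c ≤ s ∨ c ≤ t)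
    {T : Set F} (hT : T.Finite) (hT' : T.Nonempty) {d : F} (hd : IsLUB T d)
    (h : c ≤ d) : ∃ t ∈ T, c ≤ t := by
  lift T to Finset F using hT
  have hT'' : T.Nonempty := hT'
  obtain rfl : d = T.sup' hT'' id := hd.unique (by
    refine ⟨fun a ha => Finset.le_sup' id ha, fun b hb => Finset.sup'_le _ _ fun a ha => hb ha⟩)
  clear hd hT'
  induction hT'' using Finset.Nonempty.cons_induction with
  | singleton a => exact ⟨a, by simp, by simpa using h⟩
  | cons a T ha hT ih =>
    rw [Finset.sup'_cons hT] at h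
    rcases hc _ _ h with h | h
    · exact ⟨a, by simp, h⟩
    · obtain ⟨t, ht, h⟩ := ih h
      exact ⟨t, by simp only [Finset.coe_cons]; exact Or.inr ht, h⟩

end WFin

/-! ### The elements `p i j` and `m j` -/

section PM

variable {n : ℕ} {F : Type*} [Lattice F]

/-- The joinands of `p i j`. -/
def TP (x : Fin n → F) (j : ℕ) (i : Fin n) : Set F :=
  {u | u = x i ∨ ∃ k, j = k + 1 ∧ ∃ a b, a ≠ b ∧ a ≠ i ∧ b ≠ i ∧ u = freeP x k a ⊓ freeP x k b}

/-- The joinands of `m j`. -/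
def TM (x : Fin n → F) (j : ℕ) : Set F :=
  {u | ∃ a b, a ≠ b ∧ u = freeP x j a ⊓ freeP x j b}

theorem lubP (x : Fin n → F) (j : ℕ) (i : Fin n) : IsLUB (TP x j i) (freeP x j i) := by
  cases j with
  | zero =>
    have : TP x 0 i = {x i} := by
      ext u; simp [TP]
    rw [this]
    exact isLUB_singleton
  | succ k =>
    have key : ∀ c, freeP x (k + 1) i ≤ c ↔ x i ≤ c ∧ ∀ q ∈ (Finset.univ.filter
        fun q : Fin n × Fin n => q.1 ≠ q.2 ∧ q.1 ≠ i ∧ q.2 ≠ i),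
        freeP x k q.1 ⊓ freeP x k q.2 ≤ c := by
      intro c
      exact Finset.fold_op_rel_iff_and (r := fun a b : F => b ≤ a) (op := (· ⊔ ·)) sup_le_iff
    have h0 := (key _).1 le_rfl
    refine ⟨?_, fun c hc => (key c).2 ⟨hc (Or.inl rfl), fun q hq => ?_⟩⟩
    · rintro u (rfl | ⟨k', hk, a, b, h1, h2, h3, rfl⟩)
      · exact h0.1
      · obtain rfl : k = k' := by omega
        exact h0.2 (a, b) (by simp [h1, h2, h3])
    · simp only [Finset.mem_filter, Finset.mem_univ, true_and] at hq
      exact hc (Or.inr ⟨k, rfl, q.1, q.2, hq.1, hq.2.1, hq.2.2, rfl⟩)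

theorem lubM (hn : 3 ≤ n) (x : Fin n → F) (j : ℕ) : IsLUB (TM x j) (freeM hn x j) := by
  refine ⟨?_, fun c hc => Finset.sup'_le _ _ fun q hq => ?_⟩
  · rintro u ⟨a, b, h, rfl⟩
    exact Finset.le_sup' (fun q : Fin n × Fin n => freeP x j q.1 ⊓ freeP x j q.2)
      (b := (a, b)) (by simp [h])
  · simp only [Finset.mem_filter, Finset.mem_univ, true_and] at hq
    exact hc ⟨q.1, q.2, hq, rfl⟩

theorem TP_finite (x : Fin n → F) (j : ℕ) (i : Fin n) : (TP x j i).Finite := by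
  refine (Set.finite_range (fun o : Option (Fin n × Fin n) =>
    o.elim (x i) fun q => freeP x (j - 1) q.1 ⊓ freeP x (j - 1) q.2)).subset ?_
  rintro u (rfl | ⟨k, rfl, a, b, -, -, -, rfl⟩)
  · exact ⟨none, rfl⟩
  · exact ⟨some (a, b), rfl⟩

theorem TM_finite (x : Fin n → F) (j : ℕ) : (TM x j).Finite := by
  refine (Set.finite_range (fun q : Fin n × Fin n => freeP x j q.1 ⊓ freeP x j q.2)).subset ?_
  rintro u ⟨a, b, -, rfl⟩
  exact ⟨(a, b), rfl⟩

theorem TP_nonempty (x : Fin n → F) (j : ℕ) (i : Fin n) : (TP x j i).Nonempty :=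
  ⟨x i, Or.inl rfl⟩

theorem exists_two (hn : 3 ≤ n) (s : Fin n) : ∃ u v : Fin n, u ≠ v ∧ u ≠ s ∧ v ≠ s := by
  by_cases h0 : s.1 = 0
  · exact ⟨⟨1, by omega⟩, ⟨2, by omega⟩, by simp, by simp [Fin.ext_iff]; omega,
      by simp [Fin.ext_iff]; omega⟩
  by_cases h1 : s.1 = 1
  · exact ⟨⟨0, by omega⟩, ⟨2, by omega⟩, by simp, by simp [Fin.ext_iff]; omega,
      by simp [Fin.ext_iff]; omega⟩
  · exact ⟨⟨0, by omega⟩, ⟨1, by omega⟩, by simp, by simp [Fin.ext_iff]; omega,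
      by simp [Fin.ext_iff]; omega⟩

theorem TM_nonempty (hn : 3 ≤ n) (x : Fin n → F) (j : ℕ) : (TM x j).Nonempty := by
  obtain ⟨u, v, h, -⟩ := exists_two hn ⟨0, by omega⟩
  exact ⟨_, u, v, h, rfl⟩

theorem x_le_p (x : Fin n → F) (j : ℕ) (i : Fin n) : x i ≤ freeP x j i :=
  (lubP x j i).1 (Or.inl rfl)

theorem p_mono (x : Fin n → F) (j : ℕ) : ∀ i, freeP x j i ≤ freeP x (j + 1) i := by
  induction j with
  | zero => intro i; exact x_le_p x 1 i
  | succ k ih =>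
    intro i
    refine (lubP x (k + 1) i).2 ?_
    rintro u (rfl | ⟨k', hk, a, b, h1, h2, h3, rfl⟩)
    · exact x_le_p x _ i
    · obtain rfl : k = k' := by omega
      exact (inf_le_inf (ih a) (ih b)).trans
        ((lubP x (k + 2) i).1 (Or.inr ⟨k + 1, rfl, a, b, h1, h2, h3, rfl⟩))

theorem m_mono (hn : 3 ≤ n) (x : Fin n → F) : Monotone (freeM hn x) := by
  refine monotone_nat_of_le_succ fun j => (lubM hn x j).2 ?_
  rintro u ⟨a, b, h, rfl⟩
  exact (inf_le_inf (p_mono x j a) (p_mono x j b)).trans ((lubM hn x (j + 1)).1 ⟨a, b, h, rfl⟩)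

/-- Everything we need to know about the free lattice. -/
structure Ctx (x : Fin n → F) (δ : F ≃o Fᵒᵈ) : Prop where
  W : Whit F
  jp : ∀ i s t, x i ≤ s ⊔ t → x i ≤ s ∨ x i ≤ t
  inj : ∀ i j, x i ≤ x j → i = j
  fix : ∀ i, dBar δ (x i) = x i
  inv : ∀ u, dBar δ (dBar δ u) = u
  gen : latticeClosure (Set.range x) = Set.univ

variable {x : Fin n → F} {δ : F ≃o Fᵒᵈ}

theorem Ctx.le_dBar (C : Ctx x δ) {u v : F} : u ≤ dBar δ v ↔ v ≤ dBar δ u := by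
  rw [← dBar_le_dBar δ (v := u), C.inv]

theorem Ctx.dBar_le (C : Ctx x δ) {u v : F} : dBar δ u ≤ v ↔ dBar δ v ≤ u := by
  rw [← dBar_le_dBar δ (u := v), C.inv]

theorem Ctx.glb (C : Ctx x δ) {S : Set F} {c : F} (h : IsLUB S c) :
    IsGLB (dBar δ '' S) (dBar δ c) := by
  refine ⟨?_, fun b hb => ?_⟩
  · rintro _ ⟨u, hu, rfl⟩
    exact (dBar_le_dBar δ).2 (h.1 hu)
  · rw [C.le_dBar]
    refine h.2 fun u hu => ?_
    rw [C.le_dBar]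
    exact hb ⟨u, hu, rfl⟩

/-- Whitman's condition for `q j s ≤ ⋁ T`. -/
theorem Ctx.Wq (C : Ctx x δ) {j : ℕ} {s : Fin n} {T : Set F} (hT : T.Finite)
    (hT' : T.Nonempty) {d : F} (hd : IsLUB T d) (h : dBar δ (freeP x j s) ≤ d) :
    x s ≤ d ∨ (∃ k, j = k + 1 ∧ ∃ a b, a ≠ b ∧ a ≠ s ∧ b ≠ s ∧
      dBar δ (freeP x k a) ≤ d ∧ dBar δ (freeP x k b) ≤ d) ∨
      ∃ t ∈ T, dBar δ (freeP x j s) ≤ t := by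
  rcases whit_fin C.W ((TP_finite x j s).image _) ((TP_nonempty x j s).image _) hT hT'
    (C.glb (lubP x j s)) hd h with ⟨_, ⟨u, hu, rfl⟩, h⟩ | h
  · rcases hu with rfl | ⟨k, hk, a, b, h1, h2, h3, rfl⟩
    · rw [C.fix] at h
      exact Or.inl h
    · rw [dBar_inf, sup_le_iff] at h
      exact Or.inr (Or.inl ⟨k, hk, a, b, h1, h2, h3, h⟩)
  · exact Or.inr (Or.inr h)

/-- Whitman's condition for `m̄ j ≤ ⋁ T`. -/
theorem Ctx.Wm (C : Ctx x δ) (hn : 3 ≤ n) {j : ℕ} {T : Set F} (hT : T.Finite)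
    (hT' : T.Nonempty) {d : F} (hd : IsLUB T d) (h : dBar δ (freeM hn x j) ≤ d) :
    (∃ a b, a ≠ b ∧ dBar δ (freeP x j a) ≤ d ∧ dBar δ (freeP x j b) ≤ d) ∨
      ∃ t ∈ T, dBar δ (freeM hn x j) ≤ t := by
  rcases whit_fin C.W ((TM_finite x j).image _) ((TM_nonempty hn x j).image _) hT hT'
    (C.glb (lubM hn x j)) hd h with ⟨_, ⟨u, ⟨a, b, h1, rfl⟩, rfl⟩, h⟩ | h
  · rw [dBar_inf, sup_le_iff] at h
    exact Or.inl ⟨a, b, h1, h⟩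
  · exact Or.inr h

theorem pair_finite {F : Type*} (c d : F) : ({c, d} : Set F).Finite := by simp

theorem pair_nonempty {F : Type*} (c d : F) : ({c, d} : Set F).Nonempty := by simp

theorem Ctx.E0 (C : Ctx x δ) (k : ℕ) : ∀ {s t : Fin n}, s ≠ t → ¬ x s ≤ freeP x k t := by
  induction k using Nat.strong_induction_on with
  | _ k ih =>
    intro s t hst h
    obtain ⟨u, hu, h⟩ := jp_fin (C.jp s) (TP_finite x k t) (TP_nonempty x k t) (lubP x k t) h
    rcases hu with rfl | ⟨k', rfl, a, b, h1, h2, h3, rfl⟩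
    · exact hst (C.inj _ _ h)
    · rw [le_inf_iff] at h
      by_cases ha : s = a
      · exact ih k' (by omega) (fun hb => h1 (ha.symm.trans hb)) h.2
      · exact ih k' (by omega) ha h.1

theorem Ctx.E (C : Ctx x δ) (N : ℕ) : ∀ {j k : ℕ}, j + k = N → ∀ {s t : Fin n}, s ≠ t →
    ¬ dBar δ (freeP x j s) ≤ freeP x k t := by
  induction N using Nat.strong_induction_on with
  | _ N ih =>
    intro j k hN s t hst h
    rcases C.Wq (TP_finite x k t) (TP_nonempty x k t) (lubP x k t) h with
      h | ⟨j', rfl, a, b, h1, h2, h3, ha, hb⟩ | ⟨u, hu, h⟩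
    · exact C.E0 k hst h
    · by_cases hat : a = t
      · exact ih (j' + k) (by omega) rfl (fun hbt => h1 (hat.trans hbt.symm)) hb
      · exact ih (j' + k) (by omega) rfl hat ha
    · rcases hu with rfl | ⟨k', rfl, a, b, h1, h2, h3, rfl⟩
      · rw [C.dBar_le, C.fix] at h
        exact C.E0 j hst.symm h
      · rw [le_inf_iff] at h
        by_cases ha : s = a
        · exact ih (j + k') (by omega) rfl (fun hb => h1 (ha.symm.trans hb)) h.2
        · exact ih (j + k') (by omega) rfl ha h.1

theorem Ctx.E' (C : Ctx x δ) {j k : ℕ} {s t : Fin n} (hst : s ≠ t) :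
    ¬ dBar δ (freeP x j s) ≤ freeP x k t := C.E (j + k) rfl hst

theorem Ctx.q_le_x (C : Ctx x δ) (l : ℕ) (u : Fin n) : dBar δ (freeP x l u) ≤ x u := by
  rw [C.dBar_le, C.fix]
  exact x_le_p x l u

theorem Ctx.x_le_q (C : Ctx x δ) (hn : 3 ≤ n) {l : ℕ} (hl : 0 < l) (s u : Fin n) :
    ¬ x s ≤ dBar δ (freeP x l u) := by
  intro h
  have := C.inj _ _ (h.trans (C.q_le_x l u))
  subst this
  obtain ⟨a, b, h1, h2, h3⟩ := exists_two hn s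
  obtain ⟨k, rfl⟩ : ∃ k, l = k + 1 := ⟨l - 1, by omega⟩
  have h' : dBar δ (freeP x (k + 1) s) ≤ dBar δ (freeP x k a ⊓ freeP x k b) :=
    (dBar_le_dBar δ).2 ((lubP x (k + 1) s).1 (Or.inr ⟨k, rfl, a, b, h1, h2, h3, rfl⟩))
  rw [dBar_inf] at h'
  rcases C.jp _ _ _ (h.trans h') with h | h
  · exact h2 (C.inj _ _ (h.trans (C.q_le_x k a))).symm
  · exact h3 (C.inj _ _ (h.trans (C.q_le_x k b))).symm

theorem Ctx.H (C : Ctx x δ) (hn : 3 ≤ n) (i : ℕ) : ∀ {l : ℕ}, i < l → ∀ {s u v : Fin n},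
    u ≠ v → ¬ dBar δ (freeP x i s) ≤ dBar δ (freeP x l u) ⊔ dBar δ (freeP x l v) := by
  induction i using Nat.strong_induction_on with
  | _ i ih =>
    -- if `q i s` is below `q l u` then `s = u` and we go one level up
    have key : ∀ {l : ℕ}, i < l → ∀ {s u : Fin n},
        ¬ dBar δ (freeP x i s) ≤ dBar δ (freeP x l u) := by
      intro l hl s u h
      by_cases hsu : s = u
      · subst hsu
        obtain ⟨k, rfl⟩ : ∃ k, l = k + 1 := ⟨l - 1, by omega⟩
        obtain ⟨a, b, h1, h2, h3⟩ := exists_two hn s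
        have h' : dBar δ (freeP x (k + 1) s) ≤ dBar δ (freeP x k a ⊓ freeP x k b) :=
          (dBar_le_dBar δ).2 ((lubP x (k + 1) s).1 (Or.inr ⟨k, rfl, a, b, h1, h2, h3, rfl⟩))
        rw [dBar_inf] at h'
        rcases C.Wq (pair_finite _ _) (pair_nonempty _ _) isLUB_pair (h.trans h') with
          h | ⟨j', rfl, c, d, -, -, -, hc, hd⟩ | ⟨t, ht, h⟩
        · rcases C.jp _ _ _ h with h | h
          · exact h2 (C.inj _ _ (h.trans (C.q_le_x k a))).symm
          · exact h3 (C.inj _ _ (h.trans (C.q_le_x k b))).symm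
        · exact ih j' (by omega) (by omega) h1 hc
        · rcases ht with rfl | rfl
          · exact C.E' (k := 0) h2.symm (h.trans (C.q_le_x k a))
          · exact C.E' (k := 0) h3.symm (h.trans (C.q_le_x k b))
      · exact C.E' (k := 0) hsu (h.trans (C.q_le_x l u))
    intro l hl s u v huv h
    rcases C.Wq (pair_finite _ _) (pair_nonempty _ _) isLUB_pair h with
      h | ⟨j', rfl, c, d, -, -, -, hc, hd⟩ | ⟨t, ht, h⟩
    · rcases C.jp _ _ _ h with h | h
      · exact C.x_le_q hn (by omega) _ _ h
      · exact C.x_le_q hn (by omega) _ _ h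
    · exact ih j' (by omega) (by omega) huv hc
    · rcases ht with rfl | rfl
      · exact key hl h
      · exact key hl h

theorem Ctx.mbar_le (C : Ctx x δ) (hn : 3 ≤ n) {l : ℕ} {u v : Fin n} (huv : u ≠ v) :
    dBar δ (freeM hn x l) ≤ dBar δ (freeP x l u) ⊔ dBar δ (freeP x l v) := by
  rw [← dBar_inf]
  exact (dBar_le_dBar δ).2 ((lubM hn x l).1 ⟨u, v, huv, rfl⟩)

theorem Ctx.q_m (C : Ctx x δ) (hn : 3 ≤ n) (j : ℕ) : ∀ {k : ℕ} {s : Fin n},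
    ¬ dBar δ (freeP x j s) ≤ freeM hn x k := by
  induction j using Nat.strong_induction_on with
  | _ j ih =>
    intro k s h
    have aux : ∀ {c : F} {a b : Fin n}, a ≠ b → c ≤ freeP x k a ⊓ freeP x k b →
        ∃ a, s ≠ a ∧ c ≤ freeP x k a := by
      intro c a b hab h
      rw [le_inf_iff] at h
      by_cases ha : s = a
      · exact ⟨b, fun hb => hab (ha.symm.trans hb), h.2⟩
      · exact ⟨a, ha, h.1⟩
    rcases C.Wq (TM_finite x k) (TM_nonempty hn x k) (lubM hn x k) h with
      h | ⟨j', rfl, c, d, -, -, -, hc, hd⟩ | ⟨t, ⟨a, b, hab, rfl⟩, h⟩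
    · obtain ⟨t, ⟨a, b, hab, rfl⟩, h⟩ := jp_fin (C.jp s) (TM_finite x k) (TM_nonempty hn x k)
        (lubM hn x k) h
      obtain ⟨a, ha, h⟩ := aux hab h
      exact C.E0 k ha h
    · exact ih j' (by omega) hc
    · obtain ⟨a, ha, h⟩ := aux hab h
      exact C.E' ha h

theorem Ctx.x_m (C : Ctx x δ) (hn : 3 ≤ n) {k : ℕ} {s : Fin n} : ¬ x s ≤ freeM hn x k := by
  intro h
  exact C.q_m hn 0 (k := k) (s := s) (by simpa [freeP, C.fix] using h)

theorem Ctx.m_p (C : Ctx x δ) (hn : 3 ≤ n) {j : ℕ} (k : ℕ) : ∀ {i : Fin n},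
    ¬ dBar δ (freeM hn x j) ≤ freeP x k i := by
  induction k using Nat.strong_induction_on with
  | _ k ih =>
    intro i h
    rcases C.Wm hn (TP_finite x k i) (TP_nonempty x k i) (lubP x k i) h with
      ⟨a, b, hab, ha, hb⟩ | ⟨t, ht, h⟩
    · by_cases hai : a = i
      · exact C.E' (fun hbi => hab (hai.trans hbi.symm)) hb
      · exact C.E' hai ha
    · rcases ht with rfl | ⟨k', rfl, a, b, h1, h2, h3, rfl⟩
      · rw [C.dBar_le, C.fix] at h
        exact C.x_m hn h
      · exact ih k' (by omega) (h.trans inf_le_left)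

theorem Ctx.m_m (C : Ctx x δ) (hn : 3 ≤ n) {j k : ℕ} :
    ¬ dBar δ (freeM hn x j) ≤ freeM hn x k := by
  intro h
  rcases C.Wm hn (TM_finite x k) (TM_nonempty hn x k) (lubM hn x k) h with
      ⟨a, b, hab, ha, hb⟩ | ⟨t, ⟨a, b, hab, rfl⟩, h⟩
  · exact C.q_m hn j ha
  · exact C.m_p hn k (h.trans inf_le_left)

theorem Ctx.A3 (C : Ctx x δ) (hn : 3 ≤ n) (i : ℕ) : ∀ {k l : ℕ}, i < l → ∀ {s : Fin n},
    ¬ dBar δ (freeP x i s) ≤ freeM hn x k ⊔ dBar δ (freeM hn x l) := by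
  induction i using Nat.strong_induction_on with
  | _ i ih =>
    intro k l hl s h
    obtain ⟨u, v, huv, -⟩ := exists_two hn s
    rcases C.Wq (pair_finite _ _) (pair_nonempty _ _) isLUB_pair h with
      h | ⟨j', rfl, c, d, -, -, -, hc, hd⟩ | ⟨t, ht, h⟩
    · rcases C.jp _ _ _ h with h | h
      · exact C.x_m hn h
      · rcases C.jp _ _ _ (h.trans (C.mbar_le hn huv)) with h | h
        · exact C.x_le_q hn (by omega) _ _ h
        · exact C.x_le_q hn (by omega) _ _ h
    · exact ih j' (by omega) (by omega) hc
    · rcases ht with rfl | rfl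
      · exact C.q_m hn i h
      · exact C.H hn i hl huv (h.trans (C.mbar_le hn huv))

theorem Ctx.claimA (C : Ctx x δ) (hn : 3 ≤ n) {j k l : ℕ} (hl : j < l) :
    ¬ dBar δ (freeM hn x j) ≤ freeM hn x k ⊔ dBar δ (freeM hn x l) := by
  intro h
  rcases C.Wm hn (pair_finite _ _) (pair_nonempty _ _) isLUB_pair h with
    ⟨a, b, hab, ha, hb⟩ | ⟨t, ht, h⟩
  · exact C.A3 hn j hl ha
  · rcases ht with rfl | rfl
    · exact C.m_m hn h
    · obtain ⟨u, v, huv, -⟩ := exists_two hn ⟨0, by omega⟩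
      rcases C.Wm hn (pair_finite _ _) (pair_nonempty _ _) isLUB_pair
        (h.trans (C.mbar_le hn huv)) with ⟨a, b, hab, ha, hb⟩ | ⟨t, ht, h⟩
      · exact C.H hn j hl huv ha
      · rcases ht with rfl | rfl
        · exact C.m_p hn 0 (h.trans (C.q_le_x _ _))
        · exact C.m_p hn 0 (h.trans (C.q_le_x _ _))

theorem Ctx.claimB (C : Ctx x δ) (hn : 3 ≤ n) {j k l : ℕ} (hl : 1 ≤ l) (hk : k < j) :
    ¬ freeM hn x j ≤ freeM hn x k ⊔ dBar δ (freeM hn x l) := by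
  intro h
  obtain ⟨s, t, hst, -⟩ := exists_two hn ⟨0, by omega⟩
  have h1 := ((lubM hn x j).1 ⟨s, t, hst, rfl⟩).trans h
  have hx : ∀ s, ¬ freeP x j s ≤ freeM hn x k ⊔ dBar δ (freeM hn x l) := by
    intro s h
    refine C.A3 hn 0 (k := k) (l := l) (by omega) (s := s) ?_
    show dBar δ (x s) ≤ _
    rw [C.fix]
    exact (x_le_p x j s).trans h
  rcases C.W _ _ _ _ h1 with h | h | h | h
  · exact hx s h
  · exact hx t h
  · rcases whit_fin C.W (pair_finite _ _) (pair_nonempty _ _) (TM_finite x k)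
      (TM_nonempty hn x k) isGLB_pair (lubM hn x k) h with ⟨u, hu, h⟩ | ⟨u, ⟨a, b, hab, rfl⟩, h⟩
    · exact (by
        rcases hu with rfl | rfl
        · exact hx _ (le_sup_of_le_left h)
        · exact hx _ (le_sup_of_le_left h) : False)
    · have h' := (dBar_le_dBar δ).2 (h.trans inf_le_left)
      rw [dBar_inf] at h'
      exact C.H hn k hk hst h'
  · have h' := h.trans (C.mbar_le hn hst)
    have hx' : ∀ s t : Fin n, s ≠ t → ∀ r, ¬ freeP x j r ≤
        dBar δ (freeP x l s) ⊔ dBar δ (freeP x l t) := by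
      intro s t hst r h
      rcases C.jp _ _ _ ((x_le_p x j r).trans h) with h | h
      · exact C.x_le_q hn (by omega) _ _ h
      · exact C.x_le_q hn (by omega) _ _ h
    have hx2 : ∀ s t : Fin n, s ≠ t →
        ¬ freeP x j s ⊓ freeP x j t ≤ x s := by
      intro s t hst h
      have h' := (dBar_le_dBar δ).2 h
      rw [dBar_inf, C.fix] at h'
      rcases C.jp _ _ _ h' with h | h
      · exact C.x_le_q hn (by omega) _ _ h
      · exact C.x_le_q hn (by omega) _ _ h
    rcases C.W _ _ _ _ h' with h | h | h | h
    · exact hx' s t hst s h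
    · exact hx' s t hst t h
    · exact hx2 s t hst (h.trans (C.q_le_x _ _))
    · rw [inf_comm] at h
      exact hx2 t s hst.symm (h.trans (C.q_le_x _ _))

/-- The four elements. -/
def A4 (hn : 3 ≤ n) (x : Fin n → F) (δ : F ≃o Fᵒᵈ) : Bool × Bool → F
  | (false, false) => aElem hn x δ
  | (false, true) => dBar δ (aElem hn x δ)
  | (true, false) => bElem hn x δ
  | (true, true) => dBar δ (bElem hn x δ)

/-- Swap of dual generators. -/
def sw4 (i : Bool × Bool) : Bool × Bool := (i.1, !i.2)

theorem Ctx.A4_dual (C : Ctx x δ) (hn : 3 ≤ n) (i : Bool × Bool) :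
    dBar δ (A4 hn x δ i) = A4 hn x δ (sw4 i) := by
  rcases i with ⟨_ | _, _ | _⟩ <;> simp [A4, sw4, C.inv]

theorem Ctx.A4_low (C : Ctx x δ) (hn : 3 ≤ n) : Low (A4 hn x δ) := by
  have mm : ∀ {i j : ℕ}, i ≤ j → freeM hn x i ≤ freeM hn x j := fun h => m_mono hn x h
  have dd : ∀ {i j : ℕ}, i ≤ j → dBar δ (freeM hn x j) ≤ dBar δ (freeM hn x i) :=
    fun h => (dBar_le_dBar δ).2 (mm h)
  have ea : dBar δ (aElem hn x δ) = dBar δ (freeM hn x 1) ⊓ freeM hn x 3 := by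
    rw [aElem, dBar_sup, C.inv]
  have eb : dBar δ (bElem hn x δ) = dBar δ (freeM hn x 2) ⊓ freeM hn x 4 := by
    rw [bElem, dBar_sup, C.inv]
  -- a common treatment of `m̄ j ⊓ m k ≤ m l ⊔ m̄ l`
  have key : ∀ {j k l : ℕ}, 1 ≤ l → j < l → l < k →
      ¬ dBar δ (freeM hn x j) ⊓ freeM hn x k ≤ freeM hn x l ⊔ dBar δ (freeM hn x l) := by
    intro j k l h1 h2 h3 h
    rcases C.W _ _ _ _ h with h | h | h | h
    · exact C.claimA hn h2 h
    · exact C.claimB hn h1 h3 h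
    · have h' := (dBar_le_dBar δ).2 h
      rw [dBar_inf, C.inv] at h'
      exact C.claimA hn h3 h'
    · have h' := (dBar_le_dBar δ).2 h
      rw [dBar_inf, C.inv, C.inv] at h'
      exact C.claimB hn (by omega) h2 h'
  apply low_of_le
  rintro ⟨_ | _, _ | _⟩
  · refine ⟨freeM hn x 4 ⊔ dBar δ (freeM hn x 4), ?_, ?_⟩
    · rintro ⟨_ | _, _ | _⟩ hj
      · exact absurd rfl hj
      · simp only [A4, ea]
        exact le_sup_of_le_left (inf_le_of_right_le (mm (by omega)))
      · simp only [A4, bElem]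
        exact sup_le_sup (mm (by omega)) le_rfl
      · simp only [A4, eb]
        exact le_sup_of_le_left inf_le_right
    · intro h
      exact C.claimA hn (by omega) (le_sup_right.trans h)
  · refine ⟨freeM hn x 2 ⊔ dBar δ (freeM hn x 2), ?_, ?_⟩
    · rintro ⟨_ | _, _ | _⟩ hj
      · simp only [A4, aElem]
        exact sup_le_sup (mm (by omega)) (dd (by omega))
      · exact absurd rfl hj
      · simp only [A4, bElem]
        exact sup_le_sup (mm (by omega)) (dd (by omega))
      · simp only [A4, eb]
        exact le_sup_of_le_right inf_le_left
    · simp only [A4, ea]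
      exact key (by omega) (by omega) (by omega)
  · refine ⟨freeM hn x 1 ⊔ dBar δ (freeM hn x 1), ?_, ?_⟩
    · rintro ⟨_ | _, _ | _⟩ hj
      · simp only [A4, aElem]
        exact sup_le_sup (mm (by omega)) (dd (by omega))
      · simp only [A4, ea]
        exact le_sup_of_le_right inf_le_left
      · exact absurd rfl hj
      · simp only [A4, eb]
        exact le_sup_of_le_right (inf_le_of_left_le (dd (by omega)))
    · intro h
      exact C.claimB hn (by omega) (by omega) (le_sup_left.trans h)
  · refine ⟨freeM hn x 3 ⊔ dBar δ (freeM hn x 3), ?_, ?_⟩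
    · rintro ⟨_ | _, _ | _⟩ hj
      · simp only [A4, aElem]
        exact sup_le_sup (mm (by omega)) (dd (by omega))
      · simp only [A4, ea]
        exact le_sup_of_le_left inf_le_right
      · simp only [A4, bElem]
        exact sup_le_sup (mm (by omega)) (dd (by omega))
      · exact absurd rfl hj
    · simp only [A4, eb]
      exact key (by omega) (by omega) (by omega)

/-! ### Symmetry -/

theorem Ctx.perm (C : Ctx x δ) (π : F ≃o F) (i : Fin n) : ∃ j, π (x i) = x j := by
  have key : ∀ t : LTerm (Fin n), ev x t = π (x i) → ∃ j, π (x i) = x j := by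
    intro t
    induction t with
    | var j => intro h; exact ⟨j, h.symm⟩
    | sup s t hs ht =>
      intro h
      have h' : x i ≤ π.symm (ev x s) ⊔ π.symm (ev x t) := by
        rw [← map_sup, π.le_symm_apply]
        exact h.ge
      rcases C.jp _ _ _ h' with h' | h' <;> rw [π.le_symm_apply] at h'
      · exact hs (le_antisymm (le_sup_left.trans h.le) h')
      · exact ht (le_antisymm (le_sup_right.trans h.le) h')
    | inf s t hs ht =>
      intro h
      have h' : π.symm (ev x s) ⊓ π.symm (ev x t) ≤ x i := by
        rw [← map_inf, π.symm_apply_le]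
        exact h.le
      have h2 := (dBar_le_dBar δ).2 h'
      rw [dBar_inf, C.fix] at h2
      rcases C.jp _ _ _ h2 with h' | h' <;> rw [C.le_dBar, C.fix, π.symm_apply_le] at h'
      · exact hs (le_antisymm h' (h.ge.trans inf_le_left))
      · exact ht (le_antisymm h' (h.ge.trans inf_le_right))
  obtain ⟨t, ht⟩ := exists_ev x C.gen (π (x i))
  exact key t ht

theorem Ctx.symm_m (C : Ctx x δ) (hn : 3 ≤ n) (π : F ≃o F) (j : ℕ) :
    π (freeM hn x j) = freeM hn x j := by
  choose σ hσ using C.perm π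
  have hinj : Function.Injective σ := by
    intro a b hab
    have : π (x a) = π (x b) := by rw [hσ, hσ, hab]
    exact C.inj _ _ (π.injective this).le
  have hsurj := Finite.surjective_of_injective hinj
  have hp : ∀ j i, π (freeP x j i) = freeP x j (σ i) := by
    intro j
    induction j with
    | zero => intro i; exact hσ i
    | succ k ih =>
      intro i
      have h1 : IsLUB (π '' TP x (k + 1) i) (π (freeP x (k + 1) i)) :=
        (π.isLUB_image').2 (lubP x (k + 1) i)
      refine h1.unique ?_
      convert lubP x (k + 1) (σ i) using 1
      ext u
      constructor
      · rintro ⟨_, rfl | ⟨k', hk, a, b, h1, h2, h3, rfl⟩, rfl⟩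
        · exact Or.inl (hσ i)
        · obtain rfl : k = k' := by omega
          exact Or.inr ⟨k, rfl, σ a, σ b, hinj.ne h1, hinj.ne h2, hinj.ne h3, by
            rw [map_inf, ih, ih]⟩
      · rintro (rfl | ⟨k', hk, a, b, h1, h2, h3, rfl⟩)
        · exact ⟨x i, Or.inl rfl, hσ i⟩
        · obtain rfl : k = k' := by omega
          obtain ⟨a, rfl⟩ := hsurj a
          obtain ⟨b, rfl⟩ := hsurj b
          exact ⟨freeP x k a ⊓ freeP x k b, Or.inr ⟨k, rfl, a, b, fun h => h1 (by rw [h]),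
            fun h => h2 (by rw [h]), fun h => h3 (by rw [h]), rfl⟩, by
            rw [map_inf, ih, ih]⟩
  have h1 : IsLUB (π '' TM x j) (π (freeM hn x j)) := (π.isLUB_image').2 (lubM hn x j)
  refine h1.unique ?_
  convert lubM hn x j using 1
  ext u
  constructor
  · rintro ⟨_, ⟨a, b, h, rfl⟩, rfl⟩
    exact ⟨σ a, σ b, hinj.ne h, by rw [map_inf, hp, hp]⟩
  · rintro ⟨a, b, h, rfl⟩
    obtain ⟨a, rfl⟩ := hsurj a
    obtain ⟨b, rfl⟩ := hsurj b
    exact ⟨freeP x j a ⊓ freeP x j b, ⟨a, b, fun h' => h (by rw [h']), rfl⟩, by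
      rw [map_inf, hp, hp]⟩

theorem Ctx.symm_mbar (C : Ctx x δ) (hn : 3 ≤ n) (π : F ≃o F) (j : ℕ) :
    π (dBar δ (freeM hn x j)) = dBar δ (freeM hn x j) := by
  have h := C.symm_m hn ((δ.trans π.dual).trans δ.symm) j
  have h2 : δ (((δ.trans π.dual).trans δ.symm) (freeM hn x j)) = δ (freeM hn x j) := by rw [h]
  simp only [OrderIso.trans_apply, OrderIso.apply_symm_apply] at h2
  exact congrArg OrderDual.ofDual h2

theorem Ctx.A4_symm (C : Ctx x δ) (hn : 3 ≤ n) (i : Bool × Bool) :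
    IsSymmElem (A4 hn x δ i) := by
  intro π
  rcases i with ⟨_ | _, _ | _⟩ <;>
  simp only [A4, aElem, bElem, dBar_sup, C.inv, map_sup, map_inf, C.symm_m, C.symm_mbar]

end PM

/-! ### Six generators inside four, and infinitely many inside six -/

section Inf

/-- Index set with six elements. -/
abbrev S6 := (Bool × Bool) ⊕ Bool

open LTerm in
/-- Six terms in four variables. -/
def B6 : S6 → LTerm (Bool × Bool)
  | .inl (false, false) => sup (var (false, false)) (inf (var (true, false)) (var (true, true)))
  | .inl (false, true) => inf (var (false, true)) (sup (var (true, true)) (var (true, false)))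
  | .inl (true, false) => sup (var (false, false))
      (inf (var (true, true)) (sup (var (false, false)) (var (false, true))))
  | .inl (true, true) => inf (var (false, true))
      (sup (var (true, false)) (inf (var (false, true)) (var (false, false))))
  | .inr false => sup (var (false, false))
      (inf (var (true, false)) (sup (var (false, false)) (var (false, true))))
  | .inr true => inf (var (false, true))
      (sup (var (true, true)) (inf (var (false, true)) (var (false, false))))

/-- Swap of dual generators. -/
def sw6 : S6 → S6
  | .inl i => .inl (sw4 i)
  | .inr e => .inr (!e)

theorem B6_dual (j : S6) : dualT sw4 (B6 j) = B6 (sw6 j) := by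
  rcases j with ⟨_ | _, _ | _⟩ | _ | _ <;> rfl

/-- The list of the six indices. -/
def list6 : List S6 := [.inl (false, false), .inl (false, true), .inl (true, false),
  .inl (true, true), .inr false, .inr true]

/-- Join of the terms other than the `i`-th one; starts with an arbitrary other one. -/
def others (i : S6) : LTerm (Bool × Bool) :=
  (list6.filter (fun j => decide (j ≠ i))).foldr (fun j t => .sup (B6 j) t) (B6 (sw6 i))

theorem wle_others (i : S6) : wle 12 (B6 i) (others i) = false := by
  rcases i with ⟨_ | _, _ | _⟩ | _ | _ <;> decide

theorem sw4_sw4 (i : Bool × Bool) : sw4 (sw4 i) = i := by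
  rcases i with ⟨_ | _, _ | _⟩ <;> rfl

theorem sw6_sw6 (i : S6) : sw6 (sw6 i) = i := by
  rcases i with ⟨_ | _, _ | _⟩ | _ | _ <;> rfl

/-- Substitution term: the six terms written in the first four of six variables. -/
def B66 (j : S6) : LTerm S6 := sub (fun i => .var (.inl i)) (B6 j)

/-- The sequence of terms. -/
def sq : ℕ → Bool → LTerm S6
  | 0, e => .var (.inr e)
  | k + 1, e => sub B66 (sq k e)

theorem B66_dual (j : S6) : dualT sw6 (B66 j) = B66 (sw6 j) := by
  rcases j with ⟨_ | _, _ | _⟩ | _ | _ <;> rfl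

theorem sq_dual (k : ℕ) (e : Bool) : dualT sw6 (sq k e) = sq k (!e) := by
  induction k with
  | zero => rfl
  | succ k ih => rw [sq, dualT_sub B66 sw6 sw6 B66_dual, ih]; rfl

variable {F : Type*} [Lattice F] {δ : F ≃o Fᵒᵈ} {A : Bool × Bool → F}

theorem le_foldr {L : List S6} (z : LTerm (Bool × Bool)) {j : S6} (hj : j ∈ L) :
    ev A (B6 j) ≤ ev A (L.foldr (fun j t => .sup (B6 j) t) z) := by
  induction L with
  | nil => simp at hj
  | cons a L ih =>
    simp only [List.foldr_cons, ev]
    rcases List.mem_cons.1 hj with rfl | hj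
    · exact le_sup_left
    · exact le_sup_of_le_right (ih hj)

theorem C6_low (hW : Whit F) (hl : Low A) (hu : Upp A) : Low (fun j => ev A (B6 j)) := by
  apply low_of_le
  intro i
  refine ⟨ev A (others i), fun j hj => ?_, fun h => ?_⟩
  · apply le_foldr
    have : j ∈ list6 := by
      rcases j with ⟨_ | _, _ | _⟩ | _ | _ <;> simp [list6]
    simp [this, hj]
  · have := wle_of_le hW hl hu 12 _ _ h
    rw [wle_others] at this
    exact absurd this (by simp)

theorem C6_dual (hA : ∀ i, dBar δ (A i) = A (sw4 i)) (j : S6) :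
    dBar δ (ev A (B6 j)) = ev A (B6 (sw6 j)) := by
  rw [dBar_ev δ A sw4 hA, B6_dual]

/-- The infinite family. -/
def fam (A : Bool × Bool → F) (q : ℕ × Bool) : F := ev (fun j => ev A (B6 j)) (sq q.1 q.2)

theorem fam_dual (hA : ∀ i, dBar δ (A i) = A (sw4 i)) (q : ℕ × Bool) :
    dBar δ (fam A q) = fam A (q.1, !q.2) := by
  rw [fam, dBar_ev δ _ sw6 (C6_dual hA), sq_dual]
  rfl

theorem fam_low (hW : Whit F) (hl : Low A) (hu : Upp A) (hA : ∀ i, dBar δ (A i) = A (sw4 i)) :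
    Low (fam A) := by
  have hl6 := C6_low hW hl hu
  have hu6 := upp_of_low δ _ sw6 sw6_sw6 (C6_dual hA) hl6
  have key : ∀ k e, ∃ I : Set F, IsLowerSet I ∧ SupClosed I ∧
      (∀ j, j ≠ (k, e) → fam A j ∈ I) ∧ fam A (k, e) ∉ I := by
    intro k
    induction k with
    | zero =>
      intro e
      obtain ⟨I, h1, h2, h3, h4⟩ := hl6 (.inr e)
      refine ⟨I, h1, h2, ?_, h4⟩
      have aux : ∀ t : LTerm (Bool × Bool),
          ev (fun j => ev A (B6 j)) (sub (fun i => .var (.inl i)) t) ∈ I := by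
        intro t
        induction t with
        | var i => exact h3 (.inl i) (by simp)
        | sup s t hs ht => exact h2 hs ht
        | inf s t hs ht => exact h1 inf_le_left hs
      have aux2 : ∀ t : LTerm S6, ev (fun j => ev A (B6 j)) (sub B66 t) ∈ I := by
        intro t
        induction t with
        | var i => exact aux _
        | sup s t hs ht => exact h2 hs ht
        | inf s t hs ht => exact h1 inf_le_left hs
      rintro ⟨k, e'⟩ hj
      cases k with
      | zero => exact h3 (.inr e') (by simpa using hj)
      | succ k => exact aux2 _
    | succ k ih =>
      intro e
      obtain ⟨I, h1, h2, h3, h4⟩ := ih e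
      set C : S6 → F := fun j => ev A (B6 j) with hC
      refine ⟨{u | ∃ v, ev C v ∈ I ∧ u ≤ C (.inr false) ⊔ C (.inr true) ⊔ ev C (sub B66 v)},
        ?_, ?_, ?_, ?_⟩
      · rintro u u' huu ⟨v, hv, hle⟩
        exact ⟨v, hv, huu.trans hle⟩
      · rintro u ⟨v, hv, hle⟩ u' ⟨v', hv', hle'⟩
        refine ⟨.sup v v', h2 hv hv', ?_⟩
        simp only [sub, ev]
        exact sup_le (hle.trans (sup_le_sup le_rfl le_sup_left))
          (hle'.trans (sup_le_sup le_rfl le_sup_right))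
      · rintro ⟨l, e'⟩ hj
        cases l with
        | zero =>
          refine ⟨sq k (!e), h3 (k, !e) (by simp), le_sup_of_le_left ?_⟩
          cases e'
          · exact le_sup_left
          · exact le_sup_right
        | succ l =>
          exact ⟨sq l e', h3 (l, e') (by simpa using hj), le_sup_right⟩
      · rintro ⟨v, hv, hle⟩
        let z : F := A (false, false) ⊓ A (false, true) ⊓ (A (true, false) ⊓ A (true, true))
        let y : S6 → F := Sum.elim A (fun _ => z)
        have hy : ∀ t : LTerm S6, ev y (sub B66 t) = ev C t := by
          intro t
          rw [ev_sub]
          congr 1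
          funext j
          rw [B66, ev_sub]
          rfl
        have hz : ∀ t : LTerm (Bool × Bool), z ≤ ev A t := by
          intro t
          induction t with
          | var i =>
            rcases i with ⟨_ | _, _ | _⟩
            · exact inf_le_of_left_le inf_le_left
            · exact inf_le_of_left_le inf_le_right
            · exact inf_le_of_right_le inf_le_left
            · exact inf_le_of_right_le inf_le_right
          | sup s t hs ht => exact le_sup_of_le_left hs
          | inf s t hs ht => exact le_inf hs ht
        have h := crit hW hl6 hu6 y (sub B66 (sq k e))
          (.sup (.sup (.var (.inr false)) (.var (.inr true))) (sub B66 v)) hle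
        simp only [ev, hy] at h
        have hzv : z ≤ ev C v := by
          rw [hC, ← ev_sub]
          exact hz _
        exact h4 (h1 (h.trans (sup_le (sup_le hzv hzv) le_rfl)) hv)
  rintro ⟨k, e⟩
  exact key k e

theorem fam_mem {S : Set F} (hS : IsSublattice S) (h : ∀ i, A i ∈ S) (q : ℕ × Bool) :
    fam A q ∈ S :=
  ev_mem _ hS (fun _ => ev_mem _ hS h _) _

theorem exists_index {ρ : Type u} {κ : Cardinal.{u}}
    (hκ : κ = ℵ₀ ∨ ∃ k : ℕ, 4 ≤ k ∧ Even k ∧ κ = k) (hρ : #ρ = κ) :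
    Countable ρ ∧ ∃ (e : ρ → ℕ × Bool) (w : ρ → ρ), Function.Injective e ∧
      ∀ r, e (w r) = ((e r).1, !(e r).2) := by
  have main : ∀ (N : Type) (g : N → ℕ) (_ : Function.Injective g) (E : ρ ≃ N × Bool),
      ∃ (e : ρ → ℕ × Bool) (w : ρ → ρ), Function.Injective e ∧
      ∀ r, e (w r) = ((e r).1, !(e r).2) := by
    intro N g hg E
    refine ⟨fun r => (g (E r).1, (E r).2), fun r => E.symm ((E r).1, !(E r).2), ?_, ?_⟩
    · intro r r' h
      simp only [Prod.mk.injEq] at h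
      exact E.injective (Prod.ext (hg h.1) h.2)
    · intro r
      simp
  rcases hκ with rfl | ⟨k, -, ⟨m, rfl⟩, rfl⟩
  · have hc : Countable ρ := Cardinal.mk_le_aleph0_iff.1 hρ.le
    have hi : Infinite ρ := Cardinal.infinite_iff.2 hρ.ge
    obtain ⟨E⟩ : Nonempty (ρ ≃ ℕ × Bool) := nonempty_equiv_of_countable
    exact ⟨hc, main ℕ id Function.injective_id E⟩
  · have hf : Finite ρ := Cardinal.lt_aleph0_iff_finite.1 (by rw [hρ]; exact Cardinal.natCast_lt_aleph0)
    have hcard : Nat.card ρ = m + m := by rw [Nat.card, hρ]; simp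
    obtain ⟨E⟩ : Nonempty (ρ ≃ Fin m × Bool) := Finite.card_eq.1 (by rw [hcard]; simp; omega)
    exact ⟨inferInstance, main (Fin m) Fin.val Fin.val_injective E⟩

end Inf

theorem mkCtx {n : ℕ} {F : Type*} [Lattice F] (x : Fin n → F)
    (hx : IsFreelyGenerated x) (δ : F ≃o Fᵒᵈ) (hδ : ∀ i, dBar δ (x i) = x i) : Ctx x δ := by
  have hup := fun (c d : F) => up_universe x hx.2 (Dbl c d)
  refine ⟨whit_of_free x hx.1 hup, jp_of_free x hx.1 hup, fun i j h => ?_, hδ,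
    dBar_dBar δ x hx.1 hδ, hx.1⟩
  obtain ⟨φ, hφ⟩ := up_universe x hx.2 Prop (fun k => k = i)
  have : φ (x i) ≤ φ (x j) := OrderHomClass.mono φ h
  rw [hφ, hφ] at this
  exact (this rfl).symm

end TSE

theorem totally_symmetric_embedding_into_generated_sublattice {κ : Cardinal.{u}}
    (hκ : κ = ℵ₀ ∨ ∃ k : ℕ, 4 ≤ k ∧ Even k ∧ κ = k)
    {n : ℕ} (hn : 3 ≤ n) {F : Type*} [Lattice F] (x : Fin n → F)
    (hx : IsFreelyGenerated x) (δ : F ≃o Fᵒᵈ) (hδ : ∀ i, dBar δ (x i) = x i)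
    {G : Type*} [Lattice G] {ρ : Type u} (y : ρ → G) (hy : IsFreelyGenerated y)
    (hρ : #ρ = κ) :
    ∃ τ : LatticeHom G F, IsTotallySymmetricEmbedding δ τ ∧
      Set.range ⇑τ ⊆ latticeClosure ({aElem hn x δ, dBar δ (aElem hn x δ),
        bElem hn x δ, dBar δ (bElem hn x δ)} : Set F) := by
  obtain ⟨hc, e, w, he, hw⟩ := TSE.exists_index hκ hρ
  have C := TSE.mkCtx x hx δ hδ
  have hA := C.A4_dual hn
  have hl := C.A4_low hn
  have hu := TSE.upp_of_low δ _ TSE.sw4 TSE.sw4_sw4 hA hl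
  have hfl := TSE.fam_low C.W hl hu hA
  -- the family of images of the generators of `G`
  let f : ρ → F := fun r => TSE.fam (TSE.A4 hn x δ) (e r)
  have hf : ∀ r, dBar δ (f r) = f (w r) := by
    intro r
    simp only [f]
    rw [TSE.fam_dual hA, hw]
  have hww : ∀ r, w (w r) = r := by
    intro r
    apply he
    rw [hw, hw]
    simp
  have hl' : TSE.Low f := by
    intro r
    obtain ⟨I, h1, h2, h3, h4⟩ := hfl (e r)
    exact ⟨I, h1, h2, fun j hj => h3 _ (he.ne hj), h4⟩
  have hu' := TSE.upp_of_low δ f w hww hf hl'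
  obtain ⟨τ, hτ⟩ := TSE.up_universe y hy.2 F f
  have hev : ∀ t, τ (TSE.ev y t) = TSE.ev f t := by
    intro t
    rw [TSE.map_ev]
    simp only [hτ]
  have hle : ∀ u v, τ u ≤ τ v → u ≤ v := by
    intro u v h
    obtain ⟨s, rfl⟩ := TSE.exists_ev y hy.1 u
    obtain ⟨t, rfl⟩ := TSE.exists_ev y hy.1 v
    rw [hev, hev] at h
    exact TSE.crit C.W hl' hu' y s t h
  have hmem : ∀ S : Set F, IsSublattice S → (∀ i, TSE.A4 hn x δ i ∈ S) → ∀ u, τ u ∈ S := by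
    intro S hS h u
    obtain ⟨t, rfl⟩ := TSE.exists_ev y hy.1 u
    rw [hev]
    exact TSE.ev_mem _ hS (fun r => TSE.fam_mem hS h _) _
  have hdual : ∀ u, ∃ v, τ v = dBar δ (τ u) := by
    intro u
    obtain ⟨t, rfl⟩ := TSE.exists_ev y hy.1 u
    exact ⟨TSE.ev y (TSE.dualT w t), by rw [hev, hev, TSE.dBar_ev δ f w hf]⟩
  refine ⟨τ, ⟨fun u v h => le_antisymm (hle _ _ h.le) (hle _ _ h.ge), ?_, ?_⟩, ?_⟩
  · apply Set.Subset.antisymm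
    · rintro _ ⟨_, ⟨u, rfl⟩, rfl⟩
      exact hdual u
    · rintro _ ⟨u, rfl⟩
      exact ⟨dBar δ (τ u), hdual u, C.inv _⟩
  · rintro _ ⟨u, rfl⟩
    refine hmem {u | IsSymmElem u} ⟨?_, ?_⟩ (C.A4_symm hn) u
    · intro a ha b hb π
      rw [map_sup, ha π, hb π]
    · intro a ha b hb π
      rw [map_inf, ha π, hb π]
  · rintro _ ⟨u, rfl⟩
    refine hmem _ isSublattice_latticeClosure ?_ u
    rintro ⟨_ | _, _ | _⟩ <;> apply subset_latticeClosure <;> simp [TSE.A4]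
end

section
/- Let g be a symmetric element of F. If x i ≤ g for some i : Fin n, then g = ⨆ over i' < n of x i'; dually, if g ≤ x i for some i : Fin n, then g = ⨅ over i' < n of x i'. -/
open Cardinal

universe u

/-- `⨅ i < n, x i`. -/
def infGen {n : ℕ} {F : Type*} [Lattice F] (hn : 3 ≤ n) (x : Fin n → F) : F :=
  Finset.univ.inf' ⟨⟨0, by omega⟩, Finset.mem_univ _⟩ x

/-- `⨆ i < n, x i`. -/
def supGen {n : ℕ} {F : Type*} [Lattice F] (hn : 3 ≤ n) (x : Fin n → F) : F :=
  Finset.univ.sup' ⟨⟨0, by omega⟩, Finset.mem_univ _⟩ x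

universe v

/-- Lattice terms over a type of variables. -/
inductive LatTerm (ι : Type) : Type
  | var : ι → LatTerm ι
  | sup : LatTerm ι → LatTerm ι → LatTerm ι
  | inf : LatTerm ι → LatTerm ι → LatTerm ι

/-- Evaluation of terms. -/
def LatTerm.eval {ι : Type} {F : Type*} [Lattice F] (x : ι → F) : LatTerm ι → F
  | .var i => x i
  | .sup a b => a.eval x ⊔ b.eval x
  | .inf a b => a.eval x ⊓ b.eval x

/-- Induction over a generated lattice. -/
theorem gen_mem {ι : Type*} {F : Type*} [Lattice F] (x : ι → F)
    (h : latticeClosure (Set.range x) = Set.univ) (S : Set F) (hS : IsSublattice S)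
    (hxS : ∀ i, x i ∈ S) (a : F) : a ∈ S := by
  have h1 : latticeClosure (Set.range x) ⊆ S :=
    latticeClosure_min (by rintro _ ⟨i, rfl⟩; exact hxS i) hS
  rw [h] at h1
  exact h1 (Set.mem_univ a)

theorem small_of_gen {ι : Type} {F : Type*} [Lattice F] (x : ι → F)
    (h : latticeClosure (Set.range x) = Set.univ) : Small.{v} F := by
  refine small_of_surjective (f := LatTerm.eval x) fun a => ?_
  refine gen_mem x h (Set.range (LatTerm.eval x)) ⟨?_, ?_⟩ (fun i => ⟨.var i, rfl⟩) a
  · rintro _ ⟨a, rfl⟩ _ ⟨b, rfl⟩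
    exact ⟨.sup a b, rfl⟩
  · rintro _ ⟨a, rfl⟩ _ ⟨b, rfl⟩
    exact ⟨.inf a b, rfl⟩

/-- Lattice structure transported along an equivalence. -/
@[reducible] def transLattice {F : Type*} {K : Type*} [Lattice F] (e : F ≃ K) : Lattice K where
  le a b := e.symm a ≤ e.symm b
  le_refl a := le_refl _
  le_trans a b c := le_trans
  le_antisymm a b h1 h2 := e.symm.injective (le_antisymm h1 h2)
  sup a b := e (e.symm a ⊔ e.symm b)
  inf a b := e (e.symm a ⊓ e.symm b)
  le_sup_left a b := by simp
  le_sup_right a b := by simp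
  sup_le a b c h1 h2 := by simpa using ⟨h1, h2⟩
  inf_le_left a b := by simp
  inf_le_right a b := by simp
  le_inf a b c h1 h2 := by simpa using ⟨h1, h2⟩

theorem endo_exists {n : ℕ} {F : Type*} [Lattice F] (x : Fin n → F)
    (hx : IsFreelyGenerated.{_, _, v} x) (f : Fin n → F) :
    ∃ φ : F → F, (∀ a b, φ (a ⊔ b) = φ a ⊔ φ b) ∧ (∀ a b, φ (a ⊓ b) = φ a ⊓ φ b) ∧
      ∀ i, φ (x i) = f i := by
  have : Small.{v} F := small_of_gen x hx.1
  let e := equivShrink.{v} F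
  let _ : Lattice (Shrink.{v} F) := transLattice e
  obtain ⟨φ, hφ⟩ := hx.2 (Shrink.{v} F) (fun i => e (f i))
  refine ⟨fun a => e.symm (φ a), fun a b => ?_, fun a b => ?_, fun i => ?_⟩
  · simp only [map_sup]
    exact e.symm_apply_apply _
  · simp only [map_inf]
    exact e.symm_apply_apply _
  · simp only [hφ, Equiv.symm_apply_apply]

theorem aut_exists {n : ℕ} {F : Type*} [Lattice F] (x : Fin n → F)
    (hx : IsFreelyGenerated.{_, _, v} x) (i j : Fin n) :
    ∃ π : F ≃o F, π (x i) = x j := by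
  obtain ⟨φ, h1, h2, h3⟩ := endo_exists x hx (fun k => x (Equiv.swap i j k))
  have hinv : ∀ a, φ (φ a) = a := by
    refine gen_mem x hx.1 {a | φ (φ a) = a} ⟨?_, ?_⟩ ?_
    · intro a ha b hb
      simp only [Set.mem_ofPred_eq] at *
      rw [h1, h1, ha, hb]
    · intro a ha b hb
      simp only [Set.mem_ofPred_eq] at *
      rw [h2, h2, ha, hb]
    · intro k
      simp [h3]
  have hmono : Monotone φ := fun a b hab => by
    have := h1 a b
    rw [sup_eq_right.2 hab] at this
    exact sup_eq_right.1 this.symm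
  refine ⟨⟨⟨φ, φ, hinv, hinv⟩, ?_⟩, ?_⟩
  · intro a b
    refine ⟨fun h => ?_, fun h => hmono h⟩
    have := hmono h
    simpa [hinv] using this
  · simp [h3]

theorem symmetric_above_or_below_generator {n : ℕ} (hn : 3 ≤ n)
    {F : Type*} [Lattice F] (x : Fin n → F) (hx : IsFreelyGenerated x)
    (g : F) (hg : IsSymmElem g) :
    (∀ i : Fin n, x i ≤ g → g = supGen hn x) ∧
    (∀ i : Fin n, g ≤ x i → g = infGen hn x) := by
  refine ⟨fun i hi => le_antisymm ?_ ?_, fun i hi => le_antisymm ?_ ?_⟩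
  · refine gen_mem x hx.1 {a | a ≤ supGen hn x} ⟨?_, ?_⟩ ?_ g
    · intro a ha b hb
      exact sup_le ha hb
    · intro a ha b hb
      exact inf_le_left.trans ha
    · intro k
      exact Finset.le_sup' x (Finset.mem_univ k)
  · refine Finset.sup'_le _ _ fun j _ => ?_
    obtain ⟨π, hπ⟩ := aut_exists x hx i j
    have := π.monotone hi
    rwa [hπ, hg π] at this
  · refine Finset.le_inf' _ _ fun j _ => ?_
    obtain ⟨π, hπ⟩ := aut_exists x hx i j
    have := π.monotone hi
    rwa [hπ, hg π] at this
  · refine gen_mem x hx.1 {a | infGen hn x ≤ a} ⟨?_, ?_⟩ ?_ g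
    · intro a ha b hb
      exact le_trans ha le_sup_left
    · intro a ha b hb
      exact le_inf ha hb
    · intro k
      exact Finset.inf'_le x (Finset.mem_univ k)
end

section
/- Let F be a lattice freely generated by a family x : ι → F and let ψ be a dual automorphism of F. Then every fixed point of ψ is a free generator: if u ∈ F satisfies ψ u = u (under the identification of Fᵒᵈ with F), then u = x i for some i ∈ ι. -/
open Cardinal

universe u

/-- The lattice obtained from `L` by doubling the point `u`. -/
def DoubledPoint (L : Type*) [Lattice L] (u : L) : Type _ :=
  {p : L × Bool // (p.2 = true → u ≤ p.1) ∧ (p.2 = false → ¬ u < p.1)}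

open Classical in
noncomputable instance DoubledPoint.instLattice {L : Type*} [Lattice L] (u : L) :
    Lattice (DoubledPoint L u) where
  le p q := p.1 ≤ q.1
  lt p q := p.1 < q.1
  le_refl p := le_refl p.1
  le_trans p q r := @le_trans _ _ p.1 q.1 r.1
  lt_iff_le_not_ge p q := @lt_iff_le_not_ge _ _ p.1 q.1
  le_antisymm p q h h' := Subtype.ext (le_antisymm h h')
  sup p q := ⟨(p.1.1 ⊔ q.1.1, p.1.2 || q.1.2 || decide (u < p.1.1 ⊔ q.1.1)), by
    constructor
    · intro h
      simp only [Bool.or_eq_true, decide_eq_true_eq] at h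
      rcases h with (h | h) | h
      · exact (p.2.1 h).trans le_sup_left
      · exact (q.2.1 h).trans le_sup_right
      · exact h.le
    · intro h
      simp only [Bool.or_eq_false_iff, decide_eq_false_iff_not] at h
      exact h.2⟩
  le_sup_left p q := by
    refine ⟨le_sup_left, ?_⟩
    change p.1.2 ≤ (p.1.2 || q.1.2 || decide (u < p.1.1 ⊔ q.1.1))
    cases h : p.1.2 <;> simp
  le_sup_right p q := by
    refine ⟨le_sup_right, ?_⟩
    change q.1.2 ≤ (p.1.2 || q.1.2 || decide (u < p.1.1 ⊔ q.1.1))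
    cases h : q.1.2 <;> simp
  sup_le p q r hp hq := by
    have h1 : p.1.1 ⊔ q.1.1 ≤ r.1.1 := sup_le hp.1 hq.1
    refine ⟨h1, ?_⟩
    have hp2 : p.1.2 ≤ r.1.2 := hp.2
    have hq2 : q.1.2 ≤ r.1.2 := hq.2
    cases h : r.1.2
    · have h2 : ¬ u < p.1.1 ⊔ q.1.1 := fun h3 => r.2.2 h (h3.trans_le h1)
      rw [h] at hp2 hq2
      have hp3 : p.1.2 = false := le_bot_iff.1 hp2
      have hq3 : q.1.2 = false := le_bot_iff.1 hq2
      simp [h2, hp3, hq3]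
    · exact Bool.le_true _
  inf p q := ⟨(p.1.1 ⊓ q.1.1, p.1.2 && q.1.2), by
    constructor
    · intro h
      simp only [Bool.and_eq_true] at h
      exact le_inf (p.2.1 h.1) (q.2.1 h.2)
    · intro h h'
      simp only [Bool.and_eq_false_iff] at h
      rcases h with h | h
      · exact p.2.2 h (h'.trans_le inf_le_left)
      · exact q.2.2 h (h'.trans_le inf_le_right)⟩
  inf_le_left p q := ⟨inf_le_left, inf_le_left (a := p.1.2)⟩
  inf_le_right p q := ⟨inf_le_right, inf_le_right (a := p.1.2)⟩
  le_inf p q r hq hr := ⟨le_inf hq.1 hr.1, le_inf (c := p.1.2) hq.2 hr.2⟩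

theorem countable_latticeClosure {F : Type*} [Lattice F] {s : Set F} (hs : s.Countable) :
    (latticeClosure s).Countable := by
  let step : Set F → Set F := fun t =>
    t ∪ (Set.image2 (· ⊔ ·) t t ∪ Set.image2 (· ⊓ ·) t t)
  let A : ℕ → Set F := fun n => step^[n] s
  have hA : ∀ n, A (n + 1) = step (A n) := fun n => Function.iterate_succ_apply' step n s
  have hc : ∀ n, (A n).Countable := by
    intro n
    induction n with
    | zero => exact hs
    | succ n ih =>
      rw [hA]
      exact ih.union ((ih.image2 ih _).union (ih.image2 ih _))
  have hm : Monotone A := monotone_nat_of_le_succ fun n => by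
    rw [hA]; exact Set.subset_union_left
  refine (Set.countable_iUnion hc).mono (latticeClosure_min ?_ ⟨?_, ?_⟩)
  · exact Set.subset_iUnion A 0
  · intro a ha b hb
    obtain ⟨m, hm'⟩ := Set.mem_iUnion.1 ha
    obtain ⟨n, hn'⟩ := Set.mem_iUnion.1 hb
    refine Set.mem_iUnion.2 ⟨max m n + 1, ?_⟩
    rw [hA]
    exact Or.inr (Or.inl ⟨a, hm (le_max_left m n) hm', b, hm (le_max_right m n) hn', rfl⟩)
  · intro a ha b hb
    obtain ⟨m, hm'⟩ := Set.mem_iUnion.1 ha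
    obtain ⟨n, hn'⟩ := Set.mem_iUnion.1 hb
    refine Set.mem_iUnion.2 ⟨max m n + 1, ?_⟩
    rw [hA]
    exact Or.inr (Or.inr ⟨a, hm (le_max_left m n) hm', b, hm (le_max_right m n) hn', rfl⟩)

theorem exists_countable_support {F ι : Type*} [Lattice F] (x : ι → F) (y : F)
    (hy : y ∈ latticeClosure (Set.range x)) :
    ∃ s : Set F, s.Countable ∧ s ⊆ Set.range x ∧ y ∈ latticeClosure s := by
  induction hy using latticeClosure_sup_inf_induction with
  | mem a ha =>
    exact ⟨{a}, Set.countable_singleton a, by simpa using ha, subset_latticeClosure rfl⟩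
  | sup a _ b _ iha ihb =>
    obtain ⟨s, h1, h2, h3⟩ := iha
    obtain ⟨t, k1, k2, k3⟩ := ihb
    exact ⟨s ∪ t, h1.union k1, Set.union_subset h2 k2, isSublattice_latticeClosure.supClosed
      (latticeClosure_mono Set.subset_union_left h3)
      (latticeClosure_mono Set.subset_union_right k3)⟩
  | inf a _ b _ iha ihb =>
    obtain ⟨s, h1, h2, h3⟩ := iha
    obtain ⟨t, k1, k2, k3⟩ := ihb
    exact ⟨s ∪ t, h1.union k1, Set.union_subset h2 k2, isSublattice_latticeClosure.infClosed
      (latticeClosure_mono Set.subset_union_left h3)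
      (latticeClosure_mono Set.subset_union_right k3)⟩

universe w v₁ v₂ v₃

theorem exists_extension_small {F : Type v₁} [Lattice F] {ι : Type v₂} (x : ι → F)
    (hx : ∀ (K : Type w) [Lattice K] (f : ι → K), ∃ φ : LatticeHom F K, ∀ i, φ (x i) = f i)
    (K : Type v₃) [Lattice K] [Small.{w} K] (f : ι → K) :
    ∃ φ : F → K, (∀ a b, φ (a ⊔ b) = φ a ⊔ φ b) ∧ (∀ a b, φ (a ⊓ b) = φ a ⊓ φ b) ∧
      ∀ i, φ (x i) = f i := by
  let e := equivShrink.{w} K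
  let : Max (Shrink.{w} K) := ⟨fun a b => e (e.symm a ⊔ e.symm b)⟩
  let : Min (Shrink.{w} K) := ⟨fun a b => e (e.symm a ⊓ e.symm b)⟩
  let : LE (Shrink.{w} K) := ⟨fun a b => e.symm a ≤ e.symm b⟩
  let : LT (Shrink.{w} K) := ⟨fun a b => e.symm a < e.symm b⟩
  have hsup : ∀ a b : Shrink.{w} K, e.symm (a ⊔ b) = e.symm a ⊔ e.symm b :=
    fun a b => e.symm_apply_apply _
  have hinf : ∀ a b : Shrink.{w} K, e.symm (a ⊓ b) = e.symm a ⊓ e.symm b :=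
    fun a b => e.symm_apply_apply _
  let : Lattice (Shrink.{w} K) :=
    Function.Injective.lattice e.symm e.symm.injective Iff.rfl Iff.rfl hsup hinf
  obtain ⟨φ, hφ⟩ := hx (Shrink.{w} K) (fun i => e (f i))
  refine ⟨fun a => e.symm (φ a), fun a b => ?_, fun a b => ?_, fun i => ?_⟩
  · beta_reduce; rw [map_sup]; exact hsup _ _
  · beta_reduce; rw [map_inf]; exact hinf _ _
  · simp only [hφ, Equiv.symm_apply_apply]

theorem not_proper_sup_and_inf {F : Type v₁} [Lattice F] {ι : Type v₂} (x : ι → F)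
    (hgen : latticeClosure (Set.range x) = Set.univ)
    (hx : ∀ (K : Type w) [Lattice K] (f : ι → K), ∃ φ : LatticeHom F K, ∀ i, φ (x i) = f i)
    (a b c d u : F) (hab : u = a ⊓ b) (hcd : u = c ⊔ d) (ha : u < a) (hb : u < b)
    (hc : c < u) (hd : d < u) : False := by
  classical
  have key : ∀ y : F, ∃ s : Set F, s.Countable ∧ s ⊆ Set.range x ∧ y ∈ latticeClosure s :=
    fun y => exists_countable_support x y (hgen ▸ Set.mem_univ y)
  choose S hS1 hS2 hS3 using key
  let s : Set F := (S a ∪ S b) ∪ (S c ∪ S d)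
  have hs : s.Countable := ((hS1 a).union (hS1 b)).union ((hS1 c).union (hS1 d))
  have hsx : s ⊆ Set.range x := Set.union_subset (Set.union_subset (hS2 a) (hS2 b))
    (Set.union_subset (hS2 c) (hS2 d))
  let T : Sublattice F := ⟨latticeClosure s, isSublattice_latticeClosure.1,
    isSublattice_latticeClosure.2⟩
  have haT : a ∈ latticeClosure s := latticeClosure_mono (fun _ h => Or.inl (Or.inl h)) (hS3 a)
  have hbT : b ∈ latticeClosure s := latticeClosure_mono (fun _ h => Or.inl (Or.inr h)) (hS3 b)
  have hcT : c ∈ latticeClosure s := latticeClosure_mono (fun _ h => Or.inr (Or.inl h)) (hS3 c)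
  have hdT : d ∈ latticeClosure s := latticeClosure_mono (fun _ h => Or.inr (Or.inr h)) (hS3 d)
  have huT : u ∈ latticeClosure s := hab ▸ isSublattice_latticeClosure.infClosed haT hbT
  let u' : T := ⟨u, huT⟩
  have : Countable T := (countable_latticeClosure hs).to_subtype
  have : Countable (DoubledPoint T u') :=
    inferInstanceAs (Countable {p : T × Bool //
      (p.2 = true → u' ≤ p.1) ∧ (p.2 = false → ¬ u' < p.1)})
  let g : T → DoubledPoint T u' := fun y => ⟨(y, decide (u' < y)), by
    constructor
    · intro h
      exact (of_decide_eq_true h).le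
    · intro h
      exact of_decide_eq_false h⟩
  obtain ⟨φ, hsup, hinf, hφ⟩ := exists_extension_small.{w} x hx (DoubledPoint T u')
    (fun i => if h : x i ∈ latticeClosure s then g ⟨x i, h⟩ else g u')
  have hid : ∀ y ∈ latticeClosure s, ((φ y).1.1 : F) = y := by
    intro y hy
    induction hy using latticeClosure_sup_inf_induction with
    | mem y hy =>
      obtain ⟨i, rfl⟩ := hsx hy
      have h : x i ∈ latticeClosure s := subset_latticeClosure hy
      rw [hφ, dif_pos h]
    | sup y _ z _ ihy ihz =>
      rw [hsup]
      change ((φ y).1.1 : F) ⊔ ((φ z).1.1 : F) = _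
      rw [ihy, ihz]
    | inf y _ z _ ihy ihz =>
      rw [hinf]
      change ((φ y).1.1 : F) ⊓ ((φ z).1.1 : F) = _
      rw [ihy, ihz]
  have top : ∀ y ∈ latticeClosure s, u < y → (φ y).1.2 = true := by
    intro y hy h
    by_contra hne
    refine (φ y).2.2 (by simpa using hne) ?_
    change u < ((φ y).1.1 : F)
    rwa [hid y hy]
  have bot : ∀ y ∈ latticeClosure s, y < u → (φ y).1.2 = false := by
    intro y hy h
    by_contra hne
    have h2 : u ≤ ((φ y).1.1 : F) := (φ y).2.1 (by simpa using hne)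
    rw [hid y hy] at h2
    exact h.not_ge h2
  have h1 : (φ u).1.2 = true := by
    rw [hab, hinf]
    change ((φ a).1.2 && (φ b).1.2) = true
    rw [top a haT ha, top b hbT hb]; rfl
  have h2 : (φ u).1.2 = false := by
    have h3 : ¬ u' < (φ c).1.1 ⊔ (φ d).1.1 := by
      change ¬ u < ((φ c).1.1 : F) ⊔ ((φ d).1.1 : F)
      rw [hid c hcT, hid d hdT, ← hcd]
      exact lt_irrefl u
    rw [show φ u = φ c ⊔ φ d by rw [← hsup, ← hcd]]
    change ((φ c).1.2 || (φ d).1.2 || decide (u' < (φ c).1.1 ⊔ (φ d).1.1)) = false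
    rw [bot c hcT hc, bot d hdT hd]
    simpa using h3
  rw [h1] at h2
  cases h2

theorem generator_or_proper {F ι : Type*} [Lattice F] (x : ι → F) (y : F)
    (hy : y ∈ latticeClosure (Set.range x)) :
    (∃ i, y = x i) ∨ (∃ c d, y = c ⊔ d ∧ c < y ∧ d < y) ∨
      (∃ a b, y = a ⊓ b ∧ y < a ∧ y < b) := by
  induction hy using latticeClosure_sup_inf_induction with
  | mem a ha =>
    obtain ⟨i, rfl⟩ := ha
    exact Or.inl ⟨i, rfl⟩
  | sup a _ b _ iha ihb =>
    by_cases h1 : a = a ⊔ b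
    · rw [← h1]; exact iha
    by_cases h2 : b = a ⊔ b
    · rw [← h2]; exact ihb
    exact Or.inr (Or.inl ⟨a, b, rfl, lt_of_le_of_ne le_sup_left h1,
      lt_of_le_of_ne le_sup_right h2⟩)
  | inf a _ b _ iha ihb =>
    by_cases h1 : a ⊓ b = a
    · rw [h1]; exact iha
    by_cases h2 : a ⊓ b = b
    · rw [h2]; exact ihb
    exact Or.inr (Or.inr ⟨a, b, rfl, lt_of_le_of_ne inf_le_left h1,
      lt_of_le_of_ne inf_le_right h2⟩)

theorem fixed_point_of_dual_automorphism_is_generator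
    {F : Type*} [Lattice F] {ι : Type*} (x : ι → F) (hx : IsFreelyGenerated x)
    (ψ : F ≃o Fᵒᵈ) (u : F) (hu : OrderDual.ofDual (ψ u) = u) :
    ∃ i : ι, u = x i := by
  obtain ⟨hgen, hext⟩ := hx
  have hlt : ∀ y z : F, y < z → OrderDual.ofDual (ψ z) < OrderDual.ofDual (ψ y) :=
    fun y z h => OrderDual.ofDual_lt_ofDual.2 (ψ.lt_iff_lt.2 h)
  rcases generator_or_proper x u (hgen ▸ Set.mem_univ u) with h | h | h
  · exact h
  · obtain ⟨c, d, hcd, hc, hd⟩ := h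
    have h1 := hlt c u hc
    have h2 := hlt d u hd
    rw [hu] at h1 h2
    refine (not_proper_sup_and_inf x hgen hext _ _ c d u ?_ hcd h1 h2 hc hd).elim
    rw [← ofDual_sup, ← map_sup, ← hcd, hu]
  · obtain ⟨a, b, hab, ha, hb⟩ := h
    have h1 := hlt u a ha
    have h2 := hlt u b hb
    rw [hu] at h1 h2
    refine (not_proper_sup_and_inf x hgen hext a b _ _ u hab ?_ ha hb h1 h2).elim
    rw [← ofDual_inf, ← map_inf, ← hab, hu]
end

section
/- Let λ be an infinite cardinal (ℵ₀ ≤ λ), let F be a lattice freely generated by a family x : ι → F with #ι = λ, let S be a sublattice of F that is a symmetric subset of F, and let u ∈ S. Then #S = λ and the orbit {π u : π an automorphism of F} of u also has cardinality λ. -/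
open Cardinal

universe u

/-- Lattice terms over `ι`. -/
inductive LTerm (ι : Type*) where
  | var (i : ι) : LTerm ι
  | sup (s t : LTerm ι) : LTerm ι
  | inf (s t : LTerm ι) : LTerm ι

namespace LTerm

/-- Evaluate a term. -/
def eval {ι : Type*} {K : Type*} [Lattice K] (f : ι → K) : LTerm ι → K
  | var i => f i
  | sup s t => eval f s ⊔ eval f t
  | inf s t => eval f s ⊓ eval f t

/-- Rename variables. -/
def map {ι κ : Type*} (g : ι → κ) : LTerm ι → LTerm κ
  | var i => var (g i)
  | sup s t => sup (map g s) (map g t)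
  | inf s t => inf (map g s) (map g t)

open Classical in
/-- The variables occurring. -/
noncomputable def vars {ι : Type*} : LTerm ι → Finset ι
  | var i => {i}
  | sup s t => vars s ∪ vars t
  | inf s t => vars s ∪ vars t

theorem eval_map {ι κ K : Type*} [Lattice K] (g : ι → κ) (f : κ → K) (t : LTerm ι) :
    eval f (map g t) = eval (f ∘ g) t := by
  induction t with
  | var i => rfl
  | sup s t hs ht => simp [eval, map, hs, ht]
  | inf s t hs ht => simp [eval, map, hs, ht]

theorem hom_eval {ι K L : Type*} [Lattice K] [Lattice L] (φ : LatticeHom K L) (f : ι → K)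
    (t : LTerm ι) : φ (eval f t) = eval (fun i => φ (f i)) t := by
  induction t with
  | var i => rfl
  | sup s t hs ht => simp [eval, hs, ht]
  | inf s t hs ht => simp [eval, hs, ht]

theorem eval_congr {ι K : Type*} [Lattice K] {f g : ι → K} (t : LTerm ι)
    (h : ∀ i ∈ t.vars, f i = g i) : eval f t = eval g t := by
  induction t with
  | var i => exact h i (by simp [vars])
  | sup s t hs ht =>
    simp only [eval]
    rw [hs fun i hi => h i (by simp [vars, hi]), ht fun i hi => h i (by simp [vars, hi])]
  | inf s t hs ht =>
    simp only [eval]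
    rw [hs fun i hi => h i (by simp [vars, hi]), ht fun i hi => h i (by simp [vars, hi])]

theorem eval_const {ι K : Type*} [Lattice K] (c : K) (t : LTerm ι) :
    eval (fun _ => c) t = c := by
  induction t with
  | var i => rfl
  | sup s t hs ht => simp [eval, hs, ht]
  | inf s t hs ht => simp [eval, hs, ht]

/-- Arities for the encoding as a W-type. -/
def arity {ι : Type u} : ι ⊕ Bool → Type u
  | Sum.inl _ => PEmpty
  | Sum.inr _ => ULift Bool

instance {ι : Type u} (a : ι ⊕ Bool) : Finite (arity a) := by
  cases a <;> simp only [arity] <;> infer_instance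

/-- Encoding as a W-type. -/
def toW {ι : Type u} : LTerm ι → WType (arity (ι := ι))
  | var i => ⟨Sum.inl i, PEmpty.elim⟩
  | sup s t => ⟨Sum.inr true, fun b => bif b.down then toW s else toW t⟩
  | inf s t => ⟨Sum.inr false, fun b => bif b.down then toW s else toW t⟩

theorem toW_injective {ι : Type u} : Function.Injective (toW (ι := ι)) := by
  intro s
  induction s with
  | var i =>
    intro t h
    cases t <;> injection h with h1 h2 <;> cases h1
    rfl
  | sup s₁ s₂ h₁ h₂ =>
    intro t h
    cases t <;> injection h with h1 h2 <;> cases h1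
    have a := congrFun h2 ⟨true⟩
    have b := congrFun h2 ⟨false⟩
    rw [h₁ a, h₂ b]
  | inf s₁ s₂ h₁ h₂ =>
    intro t h
    cases t <;> injection h with h1 h2 <;> cases h1
    have a := congrFun h2 ⟨true⟩
    have b := congrFun h2 ⟨false⟩
    rw [h₁ a, h₂ b]

theorem card_le {ι : Type u} : #(LTerm ι) ≤ max #ι ℵ₀ := by
  refine (mk_le_of_injective toW_injective).trans
    (WType.cardinalMk_le_max_aleph0_of_finite.trans ?_)
  simp only [mk_sum, lift_uzero, max_le_iff, le_max_right, and_true]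
  refine (add_le_max _ _).trans ?_
  exact max_le (max_le (le_max_left _ _) ((by simp : _ ≤ ℵ₀).trans (le_max_right _ _))) (le_max_right _ _)

theorem eval_surjective {ι F : Type*} [Lattice F] (x : ι → F)
    (h : latticeClosure (Set.range x) = Set.univ) : Function.Surjective (eval x) := by
  have hs : IsSublattice (Set.range (eval x)) := by
    constructor
    · rintro _ ⟨s, rfl⟩ _ ⟨t, rfl⟩
      exact ⟨sup s t, rfl⟩
    · rintro _ ⟨s, rfl⟩ _ ⟨t, rfl⟩
      exact ⟨inf s t, rfl⟩
  have := latticeClosure_min (s := Set.range x) (by rintro _ ⟨i, rfl⟩; exact ⟨var i, rfl⟩) hs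
  rw [h] at this
  intro a
  exact this (Set.mem_univ a)

end LTerm

open LTerm

/-- Every countable lattice has a copy in any universe. -/
theorem exists_small_copy.{w, v} (L : Type v) [Lattice L] [Countable L] :
    ∃ (K : Type w) (_ : Lattice K), Nonempty (K ≃o L) := by
  have : Small.{w} L := Countable.toSmall L
  let e : Shrink.{w} L ≃ L := (equivShrink L).symm
  let : LE (Shrink.{w} L) := ⟨fun a b => e a ≤ e b⟩
  let : LT (Shrink.{w} L) := ⟨fun a b => e a < e b⟩
  let : Max (Shrink.{w} L) := ⟨fun a b => e.symm (e a ⊔ e b)⟩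
  let : Min (Shrink.{w} L) := ⟨fun a b => e.symm (e a ⊓ e b)⟩
  let l : Lattice (Shrink.{w} L) := Function.Injective.lattice e e.injective Iff.rfl Iff.rfl
    (fun a b => e.apply_symm_apply _) (fun a b => e.apply_symm_apply _)
  exact ⟨Shrink.{w} L, l, ⟨⟨e, Iff.rfl⟩⟩⟩

theorem eval_le_of_free.{w, v} {F ι : Type v} [Lattice F] (x : ι → F)
    (hx : IsFreelyGenerated.{v, v, w} x) (g : ι → F) (s t : LTerm ι)
    (h : eval x s ≤ eval x t) : eval g s ≤ eval g t := by
  classical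
  let W : Finset ι := s.vars ∪ t.vars
  let L : Sublattice F :=
    { carrier := Set.range (eval (fun i : W => g i))
      supClosed' := by
        rintro _ ⟨s, rfl⟩ _ ⟨t, rfl⟩
        exact ⟨sup s t, rfl⟩
      infClosed' := by
        rintro _ ⟨s, rfl⟩ _ ⟨t, rfl⟩
        exact ⟨inf s t, rfl⟩ }
  have hc : Countable (LTerm W) := by
    rw [← mk_le_aleph0_iff]
    exact card_le.trans (by simp)
  have hL : Countable L := Set.countable_range (eval (fun i : W => g i))
  obtain ⟨K, _, ⟨e⟩⟩ := exists_small_copy.{w} L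
  have hne : W.Nonempty := by
    have : s.vars.Nonempty := by
      clear h W L hc hL e
      induction s with
      | var i => simp [vars]
      | sup s t hs ht => simp [vars, hs]
      | inf s t hs ht => simp [vars, hs]
    exact this.mono Finset.subset_union_left
  obtain ⟨i₀, hi₀⟩ := hne
  have hm : ∀ i ∈ W, g i ∈ L := fun i hi => ⟨var ⟨i, hi⟩, rfl⟩
  let f : ι → L := fun i => if hi : i ∈ W then ⟨g i, hm i hi⟩ else ⟨g i₀, hm i₀ hi₀⟩
  obtain ⟨φ, hφ⟩ := hx.2 K (fun i => e.symm (f i))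
  let ψ : LatticeHom F F := L.subtype.comp ((e : LatticeHom K L).comp φ)
  have hψ : ∀ i ∈ W, ψ (x i) = g i := by
    intro i hi
    change ((e (φ (x i)) : L) : F) = g i
    rw [hφ, e.apply_symm_apply]
    simp [f, hi]
  have := OrderHomClass.mono ψ h
  rw [hom_eval, hom_eval] at this
  rwa [eval_congr s fun i hi => hψ i (Finset.mem_union_left _ hi),
    eval_congr t fun i hi => hψ i (Finset.mem_union_right _ hi)] at this

theorem exists_aut.{w, v} {F ι : Type v} [Lattice F] (x : ι → F)
    (hx : IsFreelyGenerated.{v, v, w} x) (σ : Equiv.Perm ι) :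
    ∃ π : F ≃o F, ∀ t, π (eval x t) = eval (x ∘ σ) t := by
  have hs := eval_surjective x hx.1
  choose T hT using hs
  have key : ∀ (τ : Equiv.Perm ι) t, eval (x ∘ τ) (T (eval x t)) = eval (x ∘ τ) t := fun τ t =>
    le_antisymm (eval_le_of_free x hx _ _ _ (hT _).le) (eval_le_of_free x hx _ _ _ (hT _).ge)
  have inv : ∀ (τ ρ : Equiv.Perm ι), (∀ i, ρ (τ i) = i) →
      ∀ a, eval (x ∘ ρ) (T (eval (x ∘ τ) (T a))) = a := by
    intro τ ρ h a
    rw [← eval_map τ x, key, eval_map]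
    have : (x ∘ ρ) ∘ τ = x := by ext i; simp [h]
    rw [this, hT]
  have mono : ∀ τ : Equiv.Perm ι, Monotone fun a => eval (x ∘ τ) (T a) := by
    intro τ a b hab
    refine eval_le_of_free x hx _ _ _ ?_
    rwa [hT, hT]
  refine ⟨⟨⟨fun a => eval (x ∘ σ) (T a), fun a => eval (x ∘ σ.symm) (T a),
    inv _ _ (by simp), inv _ _ (by simp)⟩, ?_⟩, key σ⟩
  intro a b
  refine ⟨fun h => ?_, fun h => mono σ h⟩
  have := mono σ.symm h
  simpa only [Equiv.coe_fn_mk, inv σ σ.symm (by simp)] using this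

theorem card_symmetric_sublattice_and_orbit {lam : Cardinal.{u}} (hlam : ℵ₀ ≤ lam)
    {F : Type u} [Lattice F] {ι : Type u} (x : ι → F) (hx : IsFreelyGenerated x)
    (hι : #ι = lam)
    (S : Set F) (hsub : IsSublattice S) (hsym : ∀ π : F ≃o F, π '' S = S)
    (u : F) (hu : u ∈ S) :
    #S = lam ∧ #{v : F | ∃ π : F ≃o F, π u = v} = lam := by
  classical
  have hF : #F ≤ lam := by
    refine (mk_le_of_surjective (eval_surjective x hx.1)).trans (card_le.trans ?_)
    rw [hι, max_eq_left hlam]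
  have hOS : {v : F | ∃ π : F ≃o F, π u = v} ⊆ S := by
    rintro _ ⟨π, rfl⟩
    rw [← hsym π]
    exact ⟨u, hu, rfl⟩
  have hO : lam ≤ #{v : F | ∃ π : F ≃o F, π u = v} := by
    obtain ⟨t, rfl⟩ := eval_surjective x hx.1 u
    let V := t.vars
    have hinf : Infinite ι := by rw [infinite_iff, hι]; exact hlam
    have hcard : #(ι × Fin V.card) ≤ #ι := by
      rw [mk_prod, lift_uzero, mk_fin, lift_natCast]
      refine (mul_le_max _ _).trans ?_
      simp only [max_le_iff, le_refl, true_and, hι]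
      exact ⟨natCast_lt_aleph0.le.trans hlam, hlam⟩
    obtain ⟨E⟩ := hcard
    have hσ : ∀ j : ι, ∃ σ : Equiv.Perm ι, ∀ k, σ (V.equivFin.symm k) = E (j, k) := by
      intro j
      let a : Fin V.card ↪ ι := V.equivFin.symm.toEmbedding.trans (Function.Embedding.subtype _)
      let b : Fin V.card ↪ ι := ⟨fun k => E (j, k), fun k l h => by simpa using E.injective h⟩
      obtain ⟨σ, h⟩ := (Equiv.Perm.isMultiplyPretransitive ι V.card).exists_smul_eq a b
      exact ⟨σ, fun k => DFunLike.congr_fun h k⟩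
    choose σ hσ using hσ
    have hσ' : ∀ j k, ∀ i ∈ V, ∀ i' ∈ V, σ j i = σ k i' → j = k := by
      intro j k i hi i' hi' h
      have h1 := hσ j (V.equivFin ⟨i, hi⟩)
      have h2 := hσ k (V.equivFin ⟨i', hi'⟩)
      simp only [Equiv.symm_apply_apply] at h1 h2
      rw [h1, h2] at h
      exact (Prod.ext_iff.1 (E.injective h)).1
    choose π hπ using fun j => exists_aut x hx (σ j)
    rw [← hι]
    refine mk_le_of_injective (f := fun j => ⟨π j (eval x t), π j, rfl⟩) ?_
    intro j k hjk
    by_contra hne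
    have h : π j (eval x t) = π k (eval x t) := congrArg Subtype.val hjk
    rw [hπ, hπ] at h
    obtain ⟨φ, hφ⟩ := hx.2 (ULift Bool) fun i => ⟨decide (∃ i' ∈ V, σ j i' = i)⟩
    have h' := congrArg φ h
    rw [hom_eval, hom_eval, eval_congr (g := fun _ => ⟨true⟩), eval_const,
      eval_congr (g := fun _ => ⟨false⟩), eval_const] at h'
    · simp at h'
    · intro i hi
      simp only [Function.comp, hφ]
      congr 1
      simp only [decide_eq_false_iff_not]
      rintro ⟨i', hi', h⟩
      exact hne (hσ' _ _ _ hi' _ hi h)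
    · intro i hi
      simp only [Function.comp, hφ]
      congr 1
      simp only [decide_eq_true_eq]
      exact ⟨i, hi, rfl⟩
  exact ⟨le_antisymm ((mk_set_le S).trans hF) (hO.trans (mk_le_mk_of_subset hOS)),
    le_antisymm ((mk_set_le _).trans hF) hO⟩
end

section
/- Let κ and λ be cardinals with 3 ≤ κ and 3 ≤ λ, let F be a lattice freely generated by a family x : ι → F with #ι = λ, let G be a lattice freely generated by a family y : ρ → G with #ρ = κ, let φ : G → F be an injective lattice homomorphism, and let S be the range of φ. Then the set of doubly irreducible elements of S — i.e. the set of u ∈ S such that for all v, w ∈ S with v ≠ u and w ≠ u one has v ⊔ w ≠ u and v ⊓ w ≠ u — has cardinality κ. -/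
open Cardinal

universe u

theorem free_lattice_induction {G : Type*} [Lattice G] {ρ : Type*} (y : ρ → G)
    (hg : latticeClosure (Set.range y) = Set.univ)
    (P : G → Prop) (hy : ∀ j, P (y j)) (hs : ∀ a b, P a → P b → P (a ⊔ b))
    (hi : ∀ a b, P a → P b → P (a ⊓ b)) (a : G) : P a := by
  have h : latticeClosure (Set.range y) ⊆ {a | P a} := by
    apply latticeClosure_min
    · rintro _ ⟨j, rfl⟩
      exact hy j
    · exact ⟨fun a ha b hb => hs a b ha hb, fun a ha b hb => hi a b ha hb⟩
  exact h (hg ▸ Set.mem_univ a)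

theorem card_doubly_irreducible_of_range {κ lam : Cardinal.{u}}
    (hκ : 3 ≤ κ) (hlam : 3 ≤ lam)
    {F : Type u} [Lattice F] {ι : Type u} (x : ι → F) (hx : IsFreelyGenerated x)
    (hι : #ι = lam)
    {G : Type*} [Lattice G] {ρ : Type u} (y : ρ → G) (hy : IsFreelyGenerated y)
    (hρ : #ρ = κ)
    (φ : LatticeHom G F) (hφ : Function.Injective φ) :
    #{u ∈ Set.range ⇑φ | ∀ v ∈ Set.range ⇑φ, ∀ w ∈ Set.range ⇑φ,
        v ≠ u → w ≠ u → v ⊔ w ≠ u ∧ v ⊓ w ≠ u} = κ := by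
  classical
  obtain ⟨hg, hu⟩ := hy
  have up : ∀ i, ∃ p : G → Bool, (∀ a b, p (a ⊔ b) = (p a || p b)) ∧
      (∀ a b, p (a ⊓ b) = (p a && p b)) ∧ ∀ j, p (y j) = decide (j = i) := by
    intro i
    obtain ⟨h, hh⟩ := hu (ULift Bool) (fun j => ⟨decide (j = i)⟩)
    refine ⟨fun a => (h a).down, fun a b => ?_, fun a b => ?_, fun j => ?_⟩
    · simp only [map_sup]; rfl
    · simp only [map_inf]; rfl
    · simp only [hh]
  have dn : ∀ i, ∃ p : G → Bool, (∀ a b, p (a ⊔ b) = (p a || p b)) ∧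
      (∀ a b, p (a ⊓ b) = (p a && p b)) ∧ ∀ j, p (y j) = !decide (j = i) := by
    intro i
    obtain ⟨h, hh⟩ := hu (ULift Bool) (fun j => ⟨!decide (j = i)⟩)
    refine ⟨fun a => (h a).down, fun a b => ?_, fun a b => ?_, fun j => ?_⟩
    · simp only [map_sup]; rfl
    · simp only [map_inf]; rfl
    · simp only [hh]
  have yinj : Function.Injective y := by
    intro i j hij
    obtain ⟨p, -, -, h⟩ := up i
    have h1 := h i
    have h2 := h j
    rw [hij, h2] at h1
    have h3 : j = i := by simpa using h1
    exact h3.symm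
  have sprime : ∀ i v w, v ⊔ w = y i → v = y i ∨ w = y i := by
    intro i v w e
    obtain ⟨p, hs, hi, h⟩ := up i
    have key : ∀ a, p a = true → y i ≤ a := by
      apply free_lattice_induction y hg (fun a => p a = true → y i ≤ a)
      · intro j hj
        rw [h] at hj
        rw [of_decide_eq_true hj]
      · intro a b ha hb hab
        rw [hs, Bool.or_eq_true] at hab
        exact hab.elim (fun q => (ha q).trans le_sup_left) (fun q => (hb q).trans le_sup_right)
      · intro a b ha hb hab
        rw [hi, Bool.and_eq_true] at hab
        exact le_inf (ha hab.1) (hb hab.2)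
    have hp : p (v ⊔ w) = true := by rw [e, h]; simp
    rw [hs, Bool.or_eq_true] at hp
    exact hp.imp (fun q => le_antisymm (e ▸ le_sup_left) (key _ q))
      (fun q => le_antisymm (e ▸ le_sup_right) (key _ q))
  have iprime : ∀ i v w, v ⊓ w = y i → v = y i ∨ w = y i := by
    intro i v w e
    obtain ⟨p, hs, hi, h⟩ := dn i
    have key : ∀ a, p a = false → a ≤ y i := by
      apply free_lattice_induction y hg (fun a => p a = false → a ≤ y i)
      · intro j hj
        rw [h] at hj
        have : j = i := by simpa using hj
        rw [this]
      · intro a b ha hb hab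
        rw [hs, Bool.or_eq_false_iff] at hab
        exact sup_le (ha hab.1) (hb hab.2)
      · intro a b ha hb hab
        rw [hi, Bool.and_eq_false_iff] at hab
        exact hab.elim (fun q => inf_le_left.trans (ha q)) (fun q => inf_le_right.trans (hb q))
    have hp : p (v ⊓ w) = false := by rw [e, h]; simp
    rw [hi, Bool.and_eq_false_iff] at hp
    exact hp.imp (fun q => le_antisymm (key _ q) (e ▸ inf_le_left))
      (fun q => le_antisymm (key _ q) (e ▸ inf_le_right))
  have hset : {u ∈ Set.range ⇑φ | ∀ v ∈ Set.range ⇑φ, ∀ w ∈ Set.range ⇑φ,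
        v ≠ u → w ≠ u → v ⊔ w ≠ u ∧ v ⊓ w ≠ u} = Set.range (fun i => φ (y i)) := by
    ext u
    constructor
    · rintro ⟨⟨g, rfl⟩, H⟩
      by_contra hn
      have hn' : ∀ j, y j ≠ g := fun j hj => hn ⟨j, by simp [hj]⟩
      have hne : Nonempty ρ := by
        rw [← Cardinal.mk_ne_zero_iff, hρ]
        rintro rfl
        simp at hκ
      refine free_lattice_induction y hg (fun a => a ≠ g) hn' ?_ ?_ g rfl
      · intro a b ha hb hab
        apply (H (φ a) ⟨a, rfl⟩ (φ b) ⟨b, rfl⟩ (hφ.ne ha) (hφ.ne hb)).1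
        rw [← map_sup, hab]
      · intro a b ha hb hab
        apply (H (φ a) ⟨a, rfl⟩ (φ b) ⟨b, rfl⟩ (hφ.ne ha) (hφ.ne hb)).2
        rw [← map_inf, hab]
    · rintro ⟨i, rfl⟩
      refine ⟨⟨y i, rfl⟩, ?_⟩
      rintro _ ⟨a, rfl⟩ _ ⟨b, rfl⟩ ha hb
      constructor
      · intro e
        rw [← map_sup] at e
        rcases sprime i a b (hφ e) with q | q
        · exact ha (by rw [q])
        · exact hb (by rw [q])
      · intro e
        rw [← map_inf] at e
        rcases iprime i a b (hφ e) with q | q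
        · exact ha (by rw [q])
        · exact hb (by rw [q])
  rw [hset]
  exact (Cardinal.mk_range_eq _ (hφ.comp yinj)).trans hρ
end
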